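/- arXiv:2301.03757 — 2 statements merged into one kernel-verified Lean document; each statement's English description precedes it below -/
import Mathlib

section
/- There exists a constant C₀ > 0 (depending only on m) with the following property: if μ > 0, k ∈ ℕ ∪ {0}, and T > 1 are such that H_μ(T) ≤ C₀, u_μ(T)·v_μ(T) > 0, and v_μ changes sign exactly k times on [0, T], then μ ∈ A_k ∪ I_k ∪ A_{k+1}. -/
open Real Filter Set Topology

noncomputable section

/-- System (S2): `u' + ((m-2)/2) u = cosh(t)^{-1/(m-1)} (u²+v²)^{1/(m-1)} v`,
    `-v' + ((m-2)/2) v = cosh(t)^{-1/(m-1)} (u²+v²)^{1/(m-1)} u`. -/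
def IsSolS2 (m : ℕ) (u v : ℝ → ℝ) : Prop :=
  ∀ t : ℝ,
    HasDerivAt u (Real.cosh t ^ (-(1 : ℝ) / ((m : ℝ) - 1))
        * ((u t) ^ 2 + (v t) ^ 2) ^ ((1 : ℝ) / ((m : ℝ) - 1)) * v t
      - (((m : ℝ) - 2) / 2) * u t) t ∧
    HasDerivAt v ((((m : ℝ) - 2) / 2) * v t
      - Real.cosh t ^ (-(1 : ℝ) / ((m : ℝ) - 1))
        * ((u t) ^ 2 + (v t) ^ 2) ^ ((1 : ℝ) / ((m : ℝ) - 1)) * u t) t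

/-- The (time-dependent) energy of (S2). -/
def H2 (m : ℕ) (t u v : ℝ) : ℝ :=
  -(((m : ℝ) - 2) / 2) * u * v
    + (((m : ℝ) - 1) / (2 * (m : ℝ))) * Real.cosh t ^ (-(1 : ℝ) / ((m : ℝ) - 1))
      * (u ^ 2 + v ^ 2) ^ ((m : ℝ) / ((m : ℝ) - 1))

/-- `w` changes sign at least `k` times on `J`. -/
def ChangesSignAtLeast (w : ℝ → ℝ) (J : Set ℝ) (k : ℕ) : Prop :=
  ∃ s : ℕ → ℝ, (∀ i, i ≤ k → s i ∈ J) ∧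
    (∀ i j, i < j → j ≤ k → s i < s j) ∧
    (∀ i, i + 1 ≤ k → w (s i) * w (s (i + 1)) < 0)

/-- `w` changes sign exactly `k` times on `J`. -/
def ChangesSignExactly (w : ℝ → ℝ) (J : Set ℝ) (k : ℕ) : Prop :=
  ChangesSignAtLeast w J k ∧ ¬ ChangesSignAtLeast w J (k + 1)

/-- The energy along the solution `(u,v)` tends (as `|t| → ∞`) to a limit in `[-∞, 0)`. -/
def EnergyNegLimit (m : ℕ) (u v : ℝ → ℝ) : Prop :=
  (∃ L : ℝ, L < 0 ∧ Tendsto (fun t => H2 m t (u t) (v t)) atTop (𝓝 L) ∧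
      Tendsto (fun t => H2 m t (u t) (v t)) atBot (𝓝 L)) ∨
  (Tendsto (fun t => H2 m t (u t) (v t)) atTop atBot ∧
      Tendsto (fun t => H2 m t (u t) (v t)) atBot atBot)

/-- `μ ∈ A_k`: `v_μ` changes sign exactly `k` times on `(0,∞)` and
    `lim_{|t|→∞} H_μ(t) < 0`. -/
def setA (m k : ℕ) : Set ℝ :=
  {μ : ℝ | 0 < μ ∧ ∃ u v : ℝ → ℝ, IsSolS2 m u v ∧ u 0 = μ ∧ v 0 = μ ∧
    ChangesSignExactly v (Set.Ioi 0) k ∧ EnergyNegLimit m u v}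

/-- `μ ∈ I_k`: `v_μ` changes sign exactly `k` times on `(0,∞)`, `H_μ > 0` on `ℝ`,
    and `(u_μ, v_μ)` is bounded. -/
def setI (m k : ℕ) : Set ℝ :=
  {μ : ℝ | 0 < μ ∧ ∃ u v : ℝ → ℝ, IsSolS2 m u v ∧ u 0 = μ ∧ v 0 = μ ∧
    ChangesSignExactly v (Set.Ioi 0) k ∧
    (∀ t : ℝ, 0 < H2 m t (u t) (v t)) ∧
    ∃ M : ℝ, ∀ t : ℝ, |u t| + |v t| ≤ M}


lemma aux_le_of_deriv {f f' : ℝ → ℝ} (hf : ∀ x, HasDerivAt f (f' x) x) {s t : ℝ} (hst : s ≤ t)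
    (h : ∀ x ∈ Ioo s t, 0 ≤ f' x) : f s ≤ f t := by
  have hm : MonotoneOn f (Icc s t) := by
    apply monotoneOn_of_deriv_nonneg (convex_Icc s t)
    · exact fun x _ => (hf x).continuousAt.continuousWithinAt
    · exact fun x _ => (hf x).differentiableAt.differentiableWithinAt
    · intro x hx
      rw [interior_Icc] at hx
      rw [(hf x).deriv]; exact h x hx
  exact hm (left_mem_Icc.2 hst) (right_mem_Icc.2 hst) hst

lemma aux_lt_of_deriv {f f' : ℝ → ℝ} (hf : ∀ x, HasDerivAt f (f' x) x) {s t : ℝ} (hst : s < t)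
    (h : ∀ x ∈ Ioo s t, 0 < f' x) : f s < f t := by
  have hm : StrictMonoOn f (Icc s t) := by
    apply strictMonoOn_of_deriv_pos (convex_Icc s t)
    · exact fun x _ => (hf x).continuousAt.continuousWithinAt
    · intro x hx
      rw [interior_Icc] at hx
      rw [(hf x).deriv]; exact h x hx
  exact hm (left_mem_Icc.2 hst.le) (right_mem_Icc.2 hst.le) hst

lemma aux_linear {f f' : ℝ → ℝ} (hf : ∀ x, HasDerivAt f (f' x) x) {s t d : ℝ} (hst : s ≤ t)
    (h : ∀ x ∈ Ioo s t, f' x ≤ -d) : f t ≤ f s - d * (t - s) := by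
  have := aux_le_of_deriv (f := fun x => - f x - d * x) (f' := fun x => - f' x - d)
    (fun x => by
      refine ((hf x).neg.sub ((hasDerivAt_id x).const_mul d)).congr_deriv ?_
      simp) hst (fun x hx => by have := h x hx; linarith)
  linarith

lemma aux_neg_persist {g g' : ℝ → ℝ} (hg : ∀ x, HasDerivAt g (g' x) x) {s t : ℝ} (hst : s < t)
    (h : ∀ x ∈ Icc s t, g x = 0 → g' x < 0) (hs : g s ≤ 0) : g t < 0 := by
  have hle : ∀ ⦃x⦄, x ∈ Icc s t → g x ≤ 0 := by
    apply image_le_of_deriv_right_lt_deriv_boundary' (f := g) (f' := g') (B := fun _ => 0)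
      (B' := fun _ => 0)
    · exact fun x _ => (hg x).continuousAt.continuousWithinAt
    · exact fun x _ => (hg x).hasDerivWithinAt
    · exact hs
    · exact continuousOn_const
    · exact fun x _ => hasDerivWithinAt_const _ _ _
    · exact fun x hx => h x ⟨hx.1, hx.2.le⟩
  rcases (hle (right_mem_Icc.2 hst.le)).lt_or_eq with h1 | h1
  · exact h1
  · exfalso
    have hd := h t (right_mem_Icc.2 hst.le) h1
    have h2 : Tendsto (slope g t) (𝓝[<] t) (𝓝 (g' t)) :=
      (hasDerivAt_iff_tendsto_slope.1 (hg t)).mono_left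
        (nhdsWithin_mono _ (fun x hx => ne_of_lt hx))
    have h3 : 0 ≤ g' t := by
      apply ge_of_tendsto h2
      filter_upwards [Ioo_mem_nhdsLT hst] with x hx
      rw [slope_def_field, h1]
      apply div_nonneg_of_nonpos
      · have := hle ⟨hx.1.le, hx.2.le⟩; linarith
      · linarith [hx.2]
    linarith

lemma aux_nonneg_no_zero {f : ℝ → ℝ} (hf : Continuous f) {s t : ℝ} (hst : s ≤ t) (hs : 0 ≤ f s)
    (h : ∀ x ∈ Ico s t, f x ≠ 0) : 0 ≤ f t := by
  by_contra hc
  push Not at hc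
  obtain ⟨x, hx, hx0⟩ := intermediate_value_Icc' hst hf.continuousOn ⟨hc.le, hs⟩
  rcases hx.2.lt_or_eq with h1 | h1
  · exact h x ⟨hx.1, h1⟩ hx0
  · rw [h1] at hx0; linarith

/-- abstract system -/
def zzA (p : ℝ) (u v : ℝ → ℝ) (t : ℝ) : ℝ := Real.cosh t ^ (-p) * ((u t)^2 + (v t)^2) ^ p

def SolA (a p : ℝ) (u v : ℝ → ℝ) : Prop := ∀ t : ℝ,
  HasDerivAt u (zzA p u v t * v t - a * u t) t ∧ HasDerivAt v (a * v t - zzA p u v t * u t) t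

def KA (p : ℝ) (u v : ℝ → ℝ) (t : ℝ) : ℝ :=
  1 / (2 * (p + 1)) * (Real.cosh t ^ (-p) * ((u t)^2 + (v t)^2) ^ (p + 1))

def HA (a p : ℝ) (u v : ℝ → ℝ) (t : ℝ) : ℝ := KA p u v t - a * (u t * v t)

lemma KA_eq {p : ℝ} (hp : 0 < p) (u v : ℝ → ℝ) (t : ℝ) :
    2 * (p + 1) * KA p u v t = zzA p u v t * ((u t)^2 + (v t)^2) := by
  unfold KA zzA
  rw [rpow_add_one' (by positivity) (by positivity)]
  field_simp

lemma zzA_pos {p : ℝ} {u v : ℝ → ℝ} {t : ℝ} (hR : 0 < (u t)^2 + (v t)^2) : 0 < zzA p u v t := by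
  unfold zzA
  have := Real.cosh_pos t
  positivity

lemma zzA_nonneg (p : ℝ) (u v : ℝ → ℝ) (t : ℝ) : 0 ≤ zzA p u v t := by
  unfold zzA
  have := Real.cosh_pos t
  positivity

lemma KA_pos {p : ℝ} (hp : 0 < p) {u v : ℝ → ℝ} {t : ℝ} (hR : 0 < (u t)^2 + (v t)^2) :
    0 < KA p u v t := by
  unfold KA
  have := Real.cosh_pos t
  positivity

lemma KA_nonneg {p : ℝ} (hp : 0 < p) (u v : ℝ → ℝ) (t : ℝ) :
    0 ≤ KA p u v t := by
  unfold KA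
  have := Real.cosh_pos t
  positivity

lemma SolA.uv {a p : ℝ} {u v : ℝ → ℝ} (S : SolA a p u v) (t : ℝ) :
    HasDerivAt (fun t => u t * v t) (zzA p u v t * ((v t)^2 - (u t)^2)) t := by
  refine ((S t).1.mul (S t).2).congr_deriv ?_
  ring

lemma SolA.R {a p : ℝ} {u v : ℝ → ℝ} (S : SolA a p u v) (t : ℝ) :
    HasDerivAt (fun t => (u t)^2 + (v t)^2) (2 * a * ((v t)^2 - (u t)^2)) t := by
  refine (((S t).1.pow 2).add ((S t).2.pow 2)).congr_deriv ?_
  push_cast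
  ring

lemma SolA.K {a p : ℝ} {u v : ℝ → ℝ} (S : SolA a p u v) (hp : 0 < p) (t : ℝ) :
    HasDerivAt (KA p u v)
      (-p * Real.tanh t * KA p u v t + a * (zzA p u v t * ((v t)^2 - (u t)^2))) t := by
  have h1 : HasDerivAt (fun t => Real.cosh t ^ (-p)) _ t :=
    (Real.hasDerivAt_cosh t).rpow_const (p := -p) (Or.inl (Real.cosh_pos t).ne')
  have h2 : HasDerivAt (fun t => ((u t)^2 + (v t)^2) ^ (p+1)) _ t :=
    (S.R t).rpow_const (p := p + 1) (Or.inr (by linarith))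
  have h3 := (h1.mul h2).const_mul (1 / (2 * (p + 1)))
  refine h3.congr_deriv ?_
  unfold KA zzA
  rw [rpow_sub_one (Real.cosh_pos t).ne', Real.tanh_eq_sinh_div_cosh, add_sub_cancel_right]
  have := (Real.cosh_pos t).ne'
  have : p + 1 ≠ 0 := by positivity
  field_simp

lemma SolA.H {a p : ℝ} {u v : ℝ → ℝ} (S : SolA a p u v) (hp : 0 < p) (t : ℝ) :
    HasDerivAt (HA a p u v) (-p * Real.tanh t * KA p u v t) t := by
  refine ((S.K hp t).sub ((S.uv t).const_mul a)).congr_deriv ?_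
  ring

lemma aux_tanh_pos {t : ℝ} (ht : 0 < t) : 0 < Real.tanh t := by
  rw [Real.tanh_eq_sinh_div_cosh]
  exact div_pos (Real.sinh_pos_iff.2 ht) (Real.cosh_pos t)

lemma aux_tanh_one {t : ℝ} (ht : 1 ≤ t) : Real.tanh 1 ≤ Real.tanh t := by
  rw [Real.tanh_eq_sinh_div_cosh, Real.tanh_eq_sinh_div_cosh,
    div_le_div_iff₀ (Real.cosh_pos _) (Real.cosh_pos _)]
  have h := Real.sinh_nonneg_iff.2 (sub_nonneg.2 ht)
  rw [Real.sinh_sub] at h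
  linarith

lemma aux_tanh_lt (t : ℝ) : Real.tanh t ≤ 1 := (Real.tanh_lt_one t).le

lemma SolA.H_le {a p : ℝ} {u v : ℝ → ℝ} (S : SolA a p u v) (hp : 0 < p) {s t : ℝ} (hs : 0 ≤ s)
    (hst : s ≤ t) : HA a p u v t ≤ HA a p u v s := by
  have := aux_linear (S.H hp) (d := 0) hst (fun x hx => by
    have h1 := aux_tanh_pos (hs.trans_lt hx.1)
    have h2 := KA_nonneg hp u v x
    have : 0 ≤ p * Real.tanh x * KA p u v x := by positivity
    linarith)
  linarith

lemma SolA.H_lt {a p : ℝ} {u v : ℝ → ℝ} (S : SolA a p u v) (hp : 0 < p)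
    (hR : ∀ t, 0 ≤ t → 0 < (u t)^2 + (v t)^2) {s t : ℝ} (hs : 0 ≤ s)
    (hst : s < t) : HA a p u v t < HA a p u v s := by
  have := aux_lt_of_deriv (fun x => (S.H hp x).neg) hst (fun x hx => by
    have h1 := aux_tanh_pos (hs.trans_lt hx.1)
    have h2 := KA_pos hp (hR x (hs.trans hx.1.le))
    have : 0 < p * Real.tanh x * KA p u v x := by positivity
    linarith)
  simp only [Pi.neg_apply] at this
  linarith

lemma SolA.R_lower {a p : ℝ} {u v : ℝ → ℝ} (S : SolA a p u v) (ha : 0 ≤ a) {t : ℝ} (ht : 0 ≤ t) :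
    ((u 0)^2 + (v 0)^2) * Real.exp (-(2 * a * t)) ≤ (u t)^2 + (v t)^2 := by
  have h : ∀ x, HasDerivAt (fun x => ((u x)^2 + (v x)^2) * Real.exp (2 * a * x))
      (4 * a * (v x)^2 * Real.exp (2 * a * x)) x := fun x => by
    have h1 : HasDerivAt (fun x => Real.exp (2 * a * x)) (Real.exp (2 * a * x) * (2 * a)) x := by
      have := ((hasDerivAt_id x).const_mul (2 * a)).exp
      simpa using this
    refine ((S.R x).mul h1).congr_deriv ?_
    ring
  have := aux_le_of_deriv h ht (fun x _ => by positivity)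
  simp only [mul_zero, Real.exp_zero, mul_one] at this
  rw [Real.exp_neg, ← div_eq_mul_inv, div_le_iff₀ (Real.exp_pos _)]
  exact this

lemma SolA.R_upper {a p : ℝ} {u v : ℝ → ℝ} (S : SolA a p u v) (ha : 0 ≤ a) {t : ℝ} (ht : 0 ≤ t) :
    (u t)^2 + (v t)^2 ≤ ((u 0)^2 + (v 0)^2) * Real.exp (2 * a * t) := by
  have h : ∀ x, HasDerivAt (fun x => -(((u x)^2 + (v x)^2) * Real.exp (-(2 * a * x))))
      (4 * a * (u x)^2 * Real.exp (-(2 * a * x))) x := fun x => by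
    have h1 : HasDerivAt (fun x => Real.exp (-(2 * a * x))) (Real.exp (-(2 * a * x)) * (-(2 * a))) x := by
      have := (((hasDerivAt_id x).const_mul (2 * a)).neg).exp
      simpa using this
    refine ((S.R x).mul h1).neg.congr_deriv ?_
    ring
  have := aux_le_of_deriv h ht (fun x _ => by positivity)
  simp only [mul_zero, neg_zero, Real.exp_zero, mul_one] at this
  rw [Real.exp_neg, ← div_eq_mul_inv, neg_le_neg_iff, div_le_iff₀ (Real.exp_pos _)] at this
  exact this

lemma SolA.R_pos {a p : ℝ} {u v : ℝ → ℝ} (S : SolA a p u v) (ha : 0 ≤ a)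
    (h0 : 0 < (u 0)^2 + (v 0)^2) (t : ℝ) (ht : 0 ≤ t) : 0 < (u t)^2 + (v t)^2 :=
  lt_of_lt_of_le (by positivity) (S.R_lower ha ht)

lemma aux_alg (u v U V M : ℝ) (hM : 0 < M) (b1 : u^2+v^2 ≤ M) (b2 : U^2+V^2 ≤ M) :
    |U^2+V^2 - (u^2+v^2)| * |(U-u) * v - (V-v) * u| ≤ 4 * M * ((U-u)^2+(V-v)^2) := by
  set x := U - u with hx
  set y := V - v with hy
  have hs : 0 ≤ x^2+y^2 := by positivity
  have q1 : (x * v - y * u)^2 ≤ M * (x^2+y^2) := by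
    have e : (x * v - y * u)^2 + (x * u + y * v)^2 = (u^2+v^2) * (x^2+y^2) := by ring
    have e' := mul_le_mul_of_nonneg_right b1 hs
    linarith [sq_nonneg (x * u + y * v)]
  have q2 : (U^2+V^2 - (u^2+v^2))^2 ≤ 4 * M * (x^2+y^2) := by
    have e : U^2+V^2 - (u^2+v^2) = x * (U + u) + y * (V + v) := by
      rw [hx, hy]; ring
    have e2 : (x * (U + u) + y * (V + v))^2 + (x * (V + v) - y * (U + u))^2
      = ((U + u)^2 + (V + v)^2) * (x^2+y^2) := by ring
    have q3 : (U + u)^2 + (V + v)^2 ≤ 4 * M := by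
      linarith [sq_nonneg (U - u), sq_nonneg (V - v)]
    have e' := mul_le_mul_of_nonneg_right q3 hs
    rw [e]
    linarith [sq_nonneg (x * (V + v) - y * (U + u))]
  rw [← abs_mul]
  apply abs_le_of_sq_le_sq _ (by positivity)
  rw [mul_pow]
  calc _ ≤ (4 * M * (x^2+y^2)) * (M * (x^2+y^2)) := by gcongr
    _ ≤ _ := by linarith [sq_nonneg (M * (x^2+y^2))]

/-- forward uniqueness -/
lemma SolA.unique {a p : ℝ} (ha : 0 ≤ a) (hp : 0 < p) (hp1 : p ≤ 1) {u v U V : ℝ → ℝ}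
    (S : SolA a p u v) (S' : SolA a p U V) (h0 : 0 < (u 0)^2 + (v 0)^2)
    (hu : U 0 = u 0) (hv : V 0 = v 0) {N : ℝ} (hN : 0 ≤ N) : U N = u N ∧ V N = v N := by
  set r := ((u 0)^2 + (v 0)^2) * Real.exp (-(2 * a * N)) with hr
  set M := ((u 0)^2 + (v 0)^2) * Real.exp (2 * a * N) with hM
  have hrpos : 0 < r := by positivity
  have hMpos : 0 < M := by positivity
  set L := p * r ^ (p - 1) with hL
  have hLpos : 0 < L := by positivity
  have lip : ∀ x y : ℝ, r ≤ x → r ≤ y → |x ^ p - y ^ p| ≤ L * |x - y| := by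
    intro x y hx hy
    have := Convex.norm_image_sub_le_of_norm_hasDerivWithin_le (𝕜 := ℝ) (f := fun x : ℝ => x ^ p)
      (f' := fun x => p * x ^ (p - 1)) (s := Ici r) (C := L)
      (fun z hz => (Real.hasDerivAt_rpow_const (Or.inl (hrpos.trans_le hz).ne')).hasDerivWithinAt)
      (fun z hz => by
        have hz0 : 0 < z := hrpos.trans_le hz
        rw [Real.norm_of_nonneg (by positivity)]
        apply mul_le_mul_of_nonneg_left _ hp.le
        exact Real.rpow_le_rpow_of_nonpos hrpos hz (by linarith))
      (convex_Ici r) (show y ∈ Ici r from hy) (show x ∈ Ici r from hx)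
    simpa using this
  set D : ℝ → ℝ := fun t => (U t - u t)^2 + (V t - v t)^2 with hD
  have lowS : ∀ t ∈ Ioo 0 N, r ≤ (u t)^2 + (v t)^2 := fun t ht =>
    le_trans (by rw [hr]; gcongr; exact ht.2.le) (S.R_lower ha ht.1.le)
  have lowS' : ∀ t ∈ Ioo 0 N, r ≤ (U t)^2 + (V t)^2 := fun t ht =>
    le_trans (by rw [hr, hu, hv]; gcongr; exact ht.2.le) (S'.R_lower ha ht.1.le)
  have upS : ∀ t ∈ Ioo 0 N, (u t)^2 + (v t)^2 ≤ M := fun t ht =>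
    le_trans (S.R_upper ha ht.1.le) (by rw [hM]; gcongr; exact ht.2.le)
  have upS' : ∀ t ∈ Ioo 0 N, (U t)^2 + (V t)^2 ≤ M := fun t ht =>
    le_trans (S'.R_upper ha ht.1.le) (by rw [hM, hu, hv]; gcongr; exact ht.2.le)
  set Q := 2 * a + 8 * L * M with hQ
  set D' : ℝ → ℝ := fun t => -2 * a * (U t - u t)^2 + 2 * a * (V t - v t)^2
    + 2 * (Real.cosh t ^ (-p) * ((((U t)^2+(V t)^2) ^ p) - ((u t)^2+(v t)^2) ^ p)
      * ((U t - u t) * v t - (V t - v t) * u t)) with hD'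
  have hDd : ∀ t, HasDerivAt D (D' t) t := fun t => by
    refine ((((S' t).1.sub (S t).1).pow 2).add (((S' t).2.sub (S t).2).pow 2)).congr_deriv ?_
    simp only [hD', zzA, Pi.sub_apply]
    push_cast
    ring
  have key : ∀ t ∈ Ioo 0 N, D' t ≤ Q * D t := by
    intro t ht
    have l1 := lip _ _ (lowS' t ht) (lowS t ht)
    have b1 := upS t ht
    have b2 := upS' t ht
    set c := Real.cosh t ^ (-p) with hc
    have hc0 : 0 ≤ c := by have := Real.cosh_pos t; positivity
    have hc1 : c ≤ 1 := Real.rpow_le_one_of_one_le_of_nonpos (Real.one_le_cosh t) (by linarith)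
    simp only [hD', hD]
    set A := ((U t)^2+(V t)^2) ^ p
    set B := ((u t)^2+(v t)^2) ^ p
    set x := U t - u t with hx
    set y := V t - v t with hy
    have e1 := aux_alg (u t) (v t) (U t) (V t) M hMpos b1 b2
    rw [← hx, ← hy] at e1
    have e2 : c * (A - B) * (x * v t - y * u t) ≤ 4 * L * M * (x^2+y^2) := by
      calc c * (A - B) * (x * v t - y * u t) ≤ |c * (A - B) * (x * v t - y * u t)| := le_abs_self _
        _ = c * (|A - B| * |x * v t - y * u t|) := by rw [abs_mul, abs_mul, abs_of_nonneg hc0]; ring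
        _ ≤ 1 * (|A - B| * |x * v t - y * u t|) := by gcongr
        _ ≤ 1 * (L * |(U t)^2+(V t)^2 - ((u t)^2+(v t)^2)| * |x * v t - y * u t|) := by gcongr
        _ = L * (|(U t)^2+(V t)^2 - ((u t)^2+(v t)^2)| * |x * v t - y * u t|) := by ring
        _ ≤ L * (4 * M * (x^2+y^2)) := by gcongr
        _ = _ := by ring
    rw [hQ]
    have e3 := mul_nonneg ha (sq_nonneg x)
    linarith
  have hfin := aux_le_of_deriv (f := fun t => -(D t * Real.exp (-(Q * t))))
    (f' := fun t => (Q * D t - D' t) * Real.exp (-(Q * t))) (fun t => by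
      have h1 : HasDerivAt (fun x => Real.exp (-(Q * x))) (Real.exp (-(Q * t)) * (-Q)) t := by
        have := (((hasDerivAt_id t).const_mul Q).neg).exp
        simpa using this
      refine ((hDd t).mul h1).neg.congr_deriv ?_
      ring) hN (fun t ht => mul_nonneg (by linarith [key t ht]) (Real.exp_pos _).le)
  have hD0 : D 0 = 0 := by simp [hD, hu, hv]
  simp only [hD0, zero_mul, neg_zero] at hfin
  have hDN : D N ≤ 0 := by
    by_contra hc
    push Not at hc
    have := mul_pos hc (Real.exp_pos (-(Q * N)))
    linarith
  simp only [hD] at hDN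
  constructor <;> nlinarith [sq_nonneg (U N - u N), sq_nonneg (V N - v N)]

/-- the constant -/
def R0A (a p : ℝ) : ℝ := (a * (p + 1)) ^ (1 / p)
def lamA (a p : ℝ) : ℝ := p + 2 * a * (p + 1)
def C0A (a p : ℝ) : ℝ := p * Real.tanh 1 * (Real.exp (-(lamA a p)) * (a * R0A a p / 2)) / 2

lemma R0A_pos {a p : ℝ} (ha : 0 < a) (hp : 0 < p) : 0 < R0A a p := by
  unfold R0A; positivity

lemma C0A_pos {a p : ℝ} (ha : 0 < a) (hp : 0 < p) : 0 < C0A a p := by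
  have := R0A_pos ha hp
  have := aux_tanh_pos one_pos
  unfold C0A; positivity

lemma SolA.K_lower {a p : ℝ} {u v : ℝ → ℝ} (S : SolA a p u v) (ha : 0 < a) (hp : 0 < p) {s t : ℝ}
    (hs : 0 ≤ s) (hst : s ≤ t) :
    KA p u v s * Real.exp (-(lamA a p * (t - s))) ≤ KA p u v t := by
  have h := aux_le_of_deriv (f := fun x => KA p u v x * Real.exp (lamA a p * (x - s)))
    (f' := fun x => ((-p * Real.tanh x * KA p u v x + a * (zzA p u v x * ((v x)^2 - (u x)^2)))
      + lamA a p * KA p u v x) * Real.exp (lamA a p * (x - s))) (fun x => by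
      have h1 : HasDerivAt (fun x => Real.exp (lamA a p * (x - s)))
          (Real.exp (lamA a p * (x - s)) * lamA a p) x := by
        have := (((hasDerivAt_id x).sub_const s).const_mul (lamA a p)).exp
        simpa using this
      refine ((S.K hp x).mul h1).congr_deriv ?_
      ring) hst (fun x hx => by
      apply mul_nonneg _ (Real.exp_pos _).le
      have e1 := KA_eq hp u v x
      have e2 := zzA_nonneg p u v x
      have e3 := KA_nonneg hp u v x
      have e4 := mul_nonneg (mul_nonneg hp.le (sub_nonneg.2 (aux_tanh_lt x))) e3
      have e5 : 0 ≤ a * (2 * (zzA p u v x * (v x)^2)) := by positivity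
      unfold lamA
      have e6 : a * (2 * (p + 1) * KA p u v x) = a * (zzA p u v x * ((u x)^2 + (v x)^2)) := by rw [e1]
      linarith)
  simp only [sub_self, mul_zero, Real.exp_zero, mul_one] at h
  rw [Real.exp_neg, ← div_eq_mul_inv, div_le_iff₀ (Real.exp_pos _)]
  exact h

/-- Lemma A -/
lemma SolA.crossing {a p : ℝ} {u v : ℝ → ℝ} (S : SolA a p u v) (ha : 0 < a) (hp : 0 < p) (hp1 : p ≤ 1)
    (hR : ∀ t, 0 ≤ t → 0 < (u t)^2 + (v t)^2) {s : ℝ} (hs : 1 ≤ s) (hH : HA a p u v s ≤ C0A a p)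
    (huv : u s = v s) :
    (∀ t, s ≤ t → 0 < u t * v t) ∧ ∃ t, s ≤ t ∧ HA a p u v t < 0 := by
  have hs0 : 0 ≤ s := by linarith
  have nonpos : ∀ t, 0 ≤ t → HA a p u v t ≤ 0 → 0 < u t * v t := by
    intro t ht h
    have := KA_pos hp (hR t ht)
    unfold HA at h
    have : 0 < a * (u t * v t) := by linarith
    exact pos_of_mul_pos_right this ha.le
  rcases le_or_gt (HA a p u v s) 0 with h0 | h0
  · refine ⟨fun t ht => nonpos t (hs0.trans ht) ((S.H_le hp hs0 ht).trans h0), s + 1, by linarith, ?_⟩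
    exact (S.H_lt hp hR hs0 (by linarith)).trans_le h0
  · have hRs := hR s hs0
    have hz : a * (p + 1) < zzA p u v s := by
      have e1 := KA_eq hp u v s
      unfold HA at h0
      have e2 : a * (p + 1) * ((u s)^2 + (v s)^2) < zzA p u v s * ((u s)^2 + (v s)^2) := by
        rw [← e1]
        have : 0 < 2 * (p + 1) * (KA p u v s - a * (u s * v s)) := by positivity
        rw [huv] at this ⊢
        linarith
      exact lt_of_mul_lt_mul_right e2 hRs.le
    have hRR : R0A a p < (u s)^2 + (v s)^2 := by
      have hc1 : Real.cosh s ^ (-p) ≤ 1 :=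
        Real.rpow_le_one_of_one_le_of_nonpos (Real.one_le_cosh s) (by linarith)
      have h1 : a * (p + 1) < ((u s)^2 + (v s)^2) ^ p := by
        refine hz.trans_le ?_
        unfold zzA
        have : 0 ≤ ((u s)^2 + (v s)^2) ^ p := by positivity
        nlinarith
      have h2 := Real.rpow_lt_rpow (by positivity) h1 (show 0 < 1 / p by positivity)
      rw [← Real.rpow_mul hRs.le, mul_one_div_cancel hp.ne', Real.rpow_one] at h2
      exact h2
    have hK : a * R0A a p / 2 < KA p u v s := by
      unfold HA at h0
      have : a * (u s * v s) = a * ((u s)^2 + (v s)^2) / 2 := by rw [huv]; ring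
      have := mul_lt_mul_of_pos_left hRR ha
      linarith
    have hlam : 0 < lamA a p := by unfold lamA; positivity
    have hKt : ∀ t, s ≤ t → t ≤ s + 1 →
        Real.exp (-(lamA a p)) * (a * R0A a p / 2) ≤ KA p u v t := by
      intro t h1 h2
      refine le_trans ?_ (S.K_lower ha hp hs0 h1)
      rw [mul_comm]
      have := R0A_pos ha hp
      have := KA_nonneg hp u v s
      have : lamA a p * (t - s) ≤ lamA a p := by nlinarith
      gcongr
    set X := Real.exp (-(lamA a p)) * (a * R0A a p / 2) with hX
    have hXpos : 0 < X := by have := R0A_pos ha hp; positivity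
    have htp := aux_tanh_pos one_pos
    have hC : C0A a p = p * Real.tanh 1 * X / 2 := rfl
    have hpt : 0 < p * Real.tanh 1 := by positivity
    have hpt1 : p * Real.tanh 1 ≤ 1 := mul_le_one₀ hp1 htp.le (aux_tanh_lt 1)
    have hlast : HA a p u v (s + 1) < 0 := by
      have := aux_linear (S.H hp) (s := s) (t := s + 1) (d := p * Real.tanh 1 * X) (by linarith)
        (fun x hx => by
          have k1 := hKt x hx.1.le hx.2.le
          have k2 := aux_tanh_one (hs.trans hx.1.le)
          have : p * Real.tanh 1 * X ≤ p * Real.tanh x * KA p u v x := by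
            have : 0 ≤ p * Real.tanh x := mul_nonneg hp.le (htp.le.trans k2)
            gcongr
          linarith)
      have : 0 < p * Real.tanh 1 * X := by positivity
      linarith
    refine ⟨fun t ht => ?_, s + 1, by linarith, hlast⟩
    rcases le_or_gt t (s + 1) with h1 | h1
    · have k1 := hKt t ht h1
      have k2 := S.H_le hp hs0 ht
      unfold HA at k2 hH
      have : 0 < a * (u t * v t) := by nlinarith
      exact pos_of_mul_pos_right this ha.le
    · exact nonpos t (hs0.trans ht) ((S.H_le hp (by linarith) h1.le).trans hlast.le)

/-- Lemma G -/
lemma SolA.growth {a p : ℝ} {u v : ℝ → ℝ} (S : SolA a p u v) (ha : 0 < a) (hp : 0 < p)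
    {s : ℝ} (hs : 1 ≤ s) (huv : 0 < u s * v s) (hvu : ∀ t, s ≤ t → (u t)^2 ≤ (v t)^2) :
    ∃ t, s ≤ t ∧ HA a p u v t < 0 := by
  by_contra hc
  push Not at hc
  have hmono : ∀ t, s ≤ t → u s * v s ≤ u t * v t := fun t ht =>
    aux_le_of_deriv S.uv ht (fun x hx => mul_nonneg (zzA_nonneg p u v x)
      (sub_nonneg.2 (hvu x hx.1.le)))
  have htp := aux_tanh_pos one_pos
  set d := p * Real.tanh 1 * (a * (u s * v s)) with hd
  have hdpos : 0 < d := by positivity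
  have h0 := hc s le_rfl
  set t := s + (HA a p u v s + 1) / d with ht
  have hst : s ≤ t := by rw [ht]; have : 0 ≤ (HA a p u v s + 1) / d := by positivity
                         linarith
  have := aux_linear (S.H hp) (d := d) hst (fun x hx => by
    have k1 := hc x hx.1.le
    have k2 := hmono x hx.1.le
    have k3 := aux_tanh_one (hs.trans hx.1.le)
    have k4 : a * (u s * v s) ≤ KA p u v x := by
      unfold HA at k1
      have := mul_le_mul_of_nonneg_left k2 ha.le
      linarith
    have : d ≤ p * Real.tanh x * KA p u v x := by
      have : 0 ≤ p * Real.tanh x := mul_nonneg hp.le (htp.le.trans k3)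
      rw [hd]; gcongr
    linarith)
  have e : d * (t - s) = HA a p u v s + 1 := by rw [ht]; field_simp; ring
  have := hc t hst
  linarith

/-- no permanent stay in the fourth quadrant -/
lemma SolA.fourth {a p : ℝ} {u v : ℝ → ℝ} (S : SolA a p u v) (ha : 1 / 2 ≤ a) (hp : 0 < p)
    {s : ℝ} (hs : 0 ≤ s) (hu : ∀ t, s ≤ t → 0 < u t) (hv : v s < 0) : False := by
  have ha0 : 0 < a := by linarith
  have hvt : ∀ t, s ≤ t → v t ≤ v s * Real.exp (a * (t - s)) := by
    intro t ht
    have h := aux_le_of_deriv (f := fun x => -(v x * Real.exp (-(a * (x - s)))))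
      (f' := fun x => zzA p u v x * u x * Real.exp (-(a * (x - s)))) (fun x => by
      have h1 : HasDerivAt (fun x => Real.exp (-(a * (x - s))))
          (Real.exp (-(a * (x - s))) * (-a)) x := by
        have := (((hasDerivAt_id x).sub_const s).const_mul a).neg.exp
        simpa using this
      refine ((S x).2.mul h1).neg.congr_deriv ?_
      ring) ht (fun x hx => mul_nonneg (mul_nonneg (zzA_nonneg p u v x) (hu x hx.1.le).le)
        (Real.exp_pos _).le)
    simp only [sub_self, mul_zero, neg_zero, Real.exp_zero, mul_one, neg_le_neg_iff] at h
    rw [Real.exp_neg, ← div_eq_mul_inv, div_le_iff₀ (Real.exp_pos _)] at h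
    exact h
  set q := (v s)^2 * Real.exp (-s) with hq
  have hv2 : 0 < (v s)^2 := by nlinarith
  have hqpos : 0 < q := by positivity
  have hz : ∀ t, s ≤ t → q ^ p ≤ zzA p u v t := by
    intro t ht
    have hcp := Real.cosh_pos t
    unfold zzA
    rw [Real.rpow_neg hcp.le, ← Real.inv_rpow hcp.le, ← Real.mul_rpow (by positivity) (by positivity)]
    apply Real.rpow_le_rpow hqpos.le _ hp.le
    rw [inv_mul_eq_div, le_div_iff₀ hcp]
    have hcosh : Real.cosh t ≤ Real.exp t := by
      rw [Real.cosh_eq]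
      have : Real.exp (-t) ≤ Real.exp t := Real.exp_le_exp.2 (by linarith)
      linarith
    have h1 := hvt t ht
    have h2 : (v s * Real.exp (a * (t - s)))^2 ≤ (v t)^2 := by
      have : 0 < Real.exp (a * (t - s)) := Real.exp_pos _
      have : v s * Real.exp (a * (t - s)) < 0 := mul_neg_of_neg_of_pos hv this
      nlinarith
    have h3 : Real.exp (t - s) ≤ (Real.exp (a * (t - s)))^2 := by
      rw [← Real.exp_nat_mul]
      apply Real.exp_le_exp.2
      push_cast
      nlinarith
    calc q * Real.cosh t ≤ q * Real.exp t := by gcongr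
      _ = (v s)^2 * Real.exp (t - s) := by rw [hq, mul_assoc, ← Real.exp_add]; ring_nf
      _ ≤ (v s)^2 * (Real.exp (a * (t - s)))^2 := by gcongr
      _ = (v s * Real.exp (a * (t - s)))^2 := by ring
      _ ≤ (v t)^2 := h2
      _ ≤ _ := by nlinarith [sq_nonneg (u t)]
  have hqp : 0 < q ^ p := by positivity
  set d := q ^ p * (- v s) with hd
  have hdpos : 0 < d := mul_pos hqp (by linarith)
  have hus := hu s le_rfl
  set t := s + u s / d with ht
  have hst : s ≤ t := by rw [ht]; have : 0 ≤ u s / d := by positivity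
                         linarith
  have := aux_linear (fun x => (S x).1) (d := d) hst (fun x hx => by
    have k1 := hz x hx.1.le
    have k2 := hu x hx.1.le
    have k3 : v x ≤ v s := by
      have := hvt x hx.1.le
      have : 1 ≤ Real.exp (a * (x - s)) := Real.one_le_exp (by nlinarith [hx.1])
      nlinarith
    have : d ≤ zzA p u v x * (- v x) := by
      have := zzA_nonneg p u v x
      rw [hd]; gcongr; linarith
    nlinarith)
  have e : d * (t - s) = u s := by rw [ht]; field_simp; ring
  have := hu t hst
  linarith

lemma SolA.cont_u {a p : ℝ} {u v : ℝ → ℝ} (S : SolA a p u v) : Continuous u :=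
  continuous_iff_continuousAt.2 fun t => (S t).1.continuousAt

lemma SolA.cont_v {a p : ℝ} {u v : ℝ → ℝ} (S : SolA a p u v) : Continuous v :=
  continuous_iff_continuousAt.2 fun t => (S t).2.continuousAt

/-- if `v ≤ u` on `[s,t]` and `v s ≤ 0` then `v t < 0`. -/
lemma SolA.v_neg {a p : ℝ} {u v : ℝ → ℝ} (S : SolA a p u v)
    (hR : ∀ t, 0 ≤ t → 0 < (u t)^2 + (v t)^2) {s t : ℝ} (hs0 : 0 ≤ s) (hst : s < t)
    (h : ∀ x ∈ Icc s t, v x ≤ u x) (hs : v s ≤ 0) : v t < 0 := by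
  refine aux_neg_persist (fun x => (S x).2) hst (fun x hx h0 => ?_) hs
  have hRx := hR x (hs0.trans hx.1)
  have hz := zzA_pos (p := p) hRx
  have h1 := h x hx
  rw [h0] at h1 hRx
  have hu : 0 < u x := lt_of_le_of_ne h1 (fun hh => by rw [← hh] at hRx; norm_num at hRx)
  rw [h0]
  nlinarith [mul_pos hz hu]

lemma SolA.u_pos {a p : ℝ} {u v : ℝ → ℝ} (S : SolA a p u v)
    (hR : ∀ t, 0 ≤ t → 0 < (u t)^2 + (v t)^2) {s t : ℝ} (hs0 : 0 ≤ s) (hst : s ≤ t)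
    (h : ∀ x ∈ Icc s t, u x ≤ v x) (hs : 0 < u s) : 0 < u t := by
  rcases hst.eq_or_lt with rfl | hst
  · exact hs
  have := aux_neg_persist (fun x => (S x).1.neg) hst (fun x hx h0 => ?_) (by simpa using hs.le)
  · simpa using this
  have hRx := hR x (hs0.trans hx.1)
  have hz := zzA_pos (p := p) hRx
  have h1 := h x hx
  have h0 : u x = 0 := by simpa using h0
  rw [h0] at h1 hRx
  have hu : 0 < v x := lt_of_le_of_ne h1 (fun hh => by rw [← hh] at hRx; norm_num at hRx)
  rw [h0]
  nlinarith [mul_pos hz hu]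

lemma aux_sign_const {f : ℝ → ℝ} (hf : Continuous f) {s t : ℝ} (hst : s ≤ t)
    (h : ∀ x, s ≤ x → f x ≠ 0) (hs : f s < 0) : f t < 0 := by
  have := aux_nonneg_no_zero hf.neg hst (by simpa using hs.le) (fun x hx => by simpa using h x hx.1)
  simp only [Pi.neg_apply, Left.nonneg_neg_iff] at this
  exact lt_of_le_of_ne this (h t hst)

lemma aux_sign_const' {f : ℝ → ℝ} (hf : Continuous f) {s t : ℝ} (hst : s ≤ t)
    (h : ∀ x, s ≤ x → f x ≠ 0) (hs : 0 < f s) : 0 < f t := by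
  have := aux_nonneg_no_zero hf hst hs.le (fun x hx => h x hx.1)
  exact lt_of_le_of_ne this (h t hst).symm

lemma SolA.main {a p : ℝ} {u v : ℝ → ℝ} (S : SolA a p u v) (ha : 1 / 2 ≤ a) (hp : 0 < p)
    (hp1 : p ≤ 1) (hR : ∀ t, 0 ≤ t → 0 < (u t)^2 + (v t)^2) {T : ℝ} (hT : 1 < T)
    (hH : HA a p u v T ≤ C0A a p) (hu : 0 < u T) (hv : 0 < v T) :
    ((∀ t, T ≤ t → 0 < v t) ∧ ∃ t, T ≤ t ∧ HA a p u v t < 0) ∨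
    ((∀ t, T ≤ t → 0 < v t) ∧ (∀ t, T ≤ t → 0 < HA a p u v t) ∧
      ∀ t, T ≤ t → (u t)^2 + (v t)^2 ≤ (u T)^2 + (v T)^2) ∨
    ((∃ t, T ≤ t ∧ v t < 0) ∧ (∀ s, T ≤ s → v s < 0 → ∀ t, s ≤ t → v t < 0) ∧
      ∃ t, T ≤ t ∧ HA a p u v t < 0) := by
  have ha0 : 0 < a := by linarith
  have hT0 : 0 ≤ T := by linarith
  have hfc : Continuous (fun t => u t - v t) := S.cont_u.sub S.cont_v
  by_cases hex : ∃ t, T ≤ t ∧ u t = v t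
  · -- least crossing
    set Z : Set ℝ := {t | T ≤ t ∧ u t = v t} with hZ
    have hZc : IsClosed Z := (isClosed_Ici).inter (isClosed_eq S.cont_u S.cont_v)
    have hZb : BddBelow Z := ⟨T, fun x hx => hx.1⟩
    obtain ⟨hτT, hτ⟩ : sInf Z ∈ Z := hZc.csInf_mem hex hZb
    have hmin : ∀ x, T ≤ x → x < sInf Z → u x ≠ v x := fun x h1 h2 h3 =>
      absurd (csInf_le hZb ⟨h1, h3⟩) (not_le.2 h2)
    set τ := sInf Z with hτdef
    obtain ⟨hA1, t1, ht1, hA2⟩ := S.crossing ha0 hp hp1 hR (by linarith)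
      ((S.H_le hp hT0 hτT).trans hH) hτ
    have hvne : ∀ x, τ ≤ x → v x ≠ 0 := fun x hx h0 => by
      have := hA1 x hx; rw [h0] at this; simp at this
    rcases le_total (v T) (u T) with hc | hc
    · have hge : ∀ x, T ≤ x → x ≤ τ → v x ≤ u x := fun x h1 h2 => by
        have := aux_nonneg_no_zero hfc h1 (sub_nonneg.2 hc) (fun y hy =>
          sub_ne_zero.2 (hmin y hy.1 (hy.2.trans_le h2)))
        exact sub_nonneg.1 this
      have hpers : ∀ s, T ≤ s → v s ≤ 0 → ∀ t, s < t → v t < 0 := by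
        intro s hs hvs t hst
        rcases le_or_gt t τ with h1 | h1
        · exact S.v_neg hR (hT0.trans hs) hst
            (fun x hx => hge x (hs.trans hx.1) (hx.2.trans h1)) hvs
        · rcases lt_or_ge s τ with h2 | h2
          · exact aux_sign_const S.cont_v h1.le hvne
              (S.v_neg hR (hT0.trans hs) h2 (fun x hx => hge x (hs.trans hx.1) hx.2) hvs)
          · exact aux_sign_const S.cont_v hst.le (fun x hx => hvne x (h2.trans hx))
              (lt_of_le_of_ne hvs (hvne s h2))
      by_cases hall : ∀ t, T ≤ t → 0 < v t
      · exact Or.inl ⟨hall, t1, hτT.trans ht1, hA2⟩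
      · push Not at hall
        obtain ⟨s, hs, hvs⟩ := hall
        refine Or.inr (Or.inr ⟨⟨s + 1, by linarith, hpers s hs hvs _ (by linarith)⟩, ?_,
          t1, hτT.trans ht1, hA2⟩)
        intro s hs hvs t hst
        rcases hst.eq_or_lt with rfl | hst
        · exact hvs
        · exact hpers s hs hvs.le t hst
    · left
      have hge : ∀ x, T ≤ x → x ≤ τ → u x ≤ v x := fun x h1 h2 => by
        have := aux_nonneg_no_zero (S.cont_v.sub S.cont_u) h1 (sub_nonneg.2 hc) (fun y hy =>
          sub_ne_zero.2 (hmin y hy.1 (hy.2.trans_le h2)).symm)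
        exact sub_nonneg.1 this
      have hvp : ∀ x, T ≤ x → x ≤ τ → 0 < v x := fun x h1 h2 =>
        (S.u_pos hR hT0 h1 (fun y hy => hge y hy.1 (hy.2.trans h2)) hu).trans_le (hge x h1 h2)
      refine ⟨fun t ht => ?_, t1, hτT.trans ht1, hA2⟩
      rcases le_or_gt t τ with h1 | h1
      · exact hvp t ht h1
      · exact aux_sign_const' S.cont_v h1.le hvne (hvp τ hτT le_rfl)
  · push Not at hex
    rcases le_total (v T) (u T) with hc | hc
    · have hge : ∀ x, T ≤ x → v x ≤ u x := fun x h1 => by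
        have := aux_nonneg_no_zero hfc h1 (sub_nonneg.2 hc) (fun y hy =>
          sub_ne_zero.2 (hex y hy.1))
        exact sub_nonneg.1 this
      by_cases hall : ∀ t, T ≤ t → 0 < v t
      · by_cases hHp : ∀ t, T ≤ t → 0 < HA a p u v t
        · refine Or.inr (Or.inl ⟨hall, hHp, fun t ht => ?_⟩)
          have := aux_linear S.R (d := 0) ht (fun x hx => by
            have h1 := hge x hx.1.le
            have h2 := hall x hx.1.le
            have : (v x)^2 ≤ (u x)^2 := by nlinarith
            nlinarith)
          linarith
        · push Not at hHp
          obtain ⟨t, ht, hHt⟩ := hHp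
          exact Or.inl ⟨hall, t + 1, by linarith,
            (S.H_lt hp hR (hT0.trans ht) (by linarith)).trans_le hHt⟩
      · push Not at hall
        obtain ⟨s, hs, hvs⟩ := hall
        have hpers : ∀ s, T ≤ s → v s ≤ 0 → ∀ t, s < t → v t < 0 := fun s hs hvs t hst =>
          S.v_neg hR (hT0.trans hs) hst (fun x hx => hge x (hs.trans hx.1)) hvs
        refine Or.inr (Or.inr ⟨⟨s + 1, by linarith, hpers s hs hvs _ (by linarith)⟩, ?_, ?_⟩)
        · intro s hs hvs t hst
          rcases hst.eq_or_lt with rfl | hst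
          · exact hvs
          · exact hpers s hs hvs.le t hst
        · have hvneg : ∀ t, s + 1 ≤ t → v t < 0 := fun t ht => hpers s hs hvs t (by linarith)
          by_cases hup : ∀ t, s + 1 ≤ t → 0 < u t
          · exact (S.fourth ha hp (by linarith) hup (hvneg _ le_rfl)).elim
          · push Not at hup
            obtain ⟨r, hr, hur⟩ := hup
            have hun : ∀ t, r < t → u t < 0 := fun t ht => by
              refine aux_neg_persist (fun x => (S x).1) ht (fun x hx h0 => ?_) hur
              have hz := zzA_pos (p := p) (hR x (by linarith [hx.1]))
              have := hvneg x (hr.trans hx.1)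
              rw [h0]
              nlinarith [mul_pos hz (neg_pos.2 this)]
            obtain ⟨t, ht, hHt⟩ := S.growth ha0 hp (s := r + 1) (by linarith)
              (mul_pos_of_neg_of_neg (hun _ (by linarith)) (hvneg _ (by linarith)))
              (fun t ht => by
                have h1 := hge t (by linarith)
                have h2 := hun t (by linarith)
                nlinarith)
            exact ⟨t, by linarith, hHt⟩
    · have hge : ∀ x, T ≤ x → u x ≤ v x := fun x h1 => by
        have := aux_nonneg_no_zero (S.cont_v.sub S.cont_u) h1 (sub_nonneg.2 hc) (fun y hy =>
          sub_ne_zero.2 (hex y hy.1).symm)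
        exact sub_nonneg.1 this
      have hup : ∀ x, T ≤ x → 0 < u x := fun x h1 =>
        S.u_pos hR hT0 h1 (fun y hy => hge y hy.1) hu
      refine Or.inl ⟨fun t ht => (hup t ht).trans_le (hge t ht), ?_⟩
      exact S.growth ha0 hp hT.le (mul_pos hu hv) (fun t ht => by
        have h1 := hge t ht
        have h2 := hup t ht
        nlinarith)

lemma sc_mono {w : ℝ → ℝ} {J J' : Set ℝ} (h : J ⊆ J') {k : ℕ} (hc : ChangesSignAtLeast w J k) :
    ChangesSignAtLeast w J' k := by
  obtain ⟨s, h1, h2, h3⟩ := hc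
  exact ⟨s, fun i hi => h (h1 i hi), h2, h3⟩

lemma sc_neg {w : ℝ → ℝ} {J : Set ℝ} {k : ℕ} :
    ChangesSignAtLeast (fun t => - w t) J k ↔ ChangesSignAtLeast w J k := by
  simp only [ChangesSignAtLeast, neg_mul_neg]

lemma sce_neg {w : ℝ → ℝ} {J : Set ℝ} {k : ℕ} :
    ChangesSignExactly (fun t => - w t) J k ↔ ChangesSignExactly w J k := by
  simp only [ChangesSignExactly, sc_neg]

lemma sc_nudge {w : ℝ → ℝ} (hw : Continuous w) (h0 : w 0 ≠ 0) {k : ℕ}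
    (hc : ChangesSignAtLeast w (Ici 0) k) : ChangesSignAtLeast w (Ioi 0) k := by
  obtain ⟨s, h1, h2, h3⟩ := hc
  have hpos : ∀ i, 1 ≤ i → i ≤ k → 0 < s i := fun i hi hik =>
    lt_of_le_of_lt (h1 0 (by omega)) (h2 0 i (by omega) hik)
  rcases (show (0:ℝ) ≤ s 0 from h1 0 (by omega)).lt_or_eq with hs0 | hs0
  · refine ⟨s, fun i hi => ?_, h2, h3⟩
    rcases Nat.eq_zero_or_pos i with rfl | h
    · exact hs0
    · exact hpos i h hi
  -- s 0 = 0
  have hb : ∃ b > 0, (1 ≤ k → b ≤ s 1) := by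
    by_cases hk : 1 ≤ k
    · exact ⟨s 1, hpos 1 le_rfl hk, fun _ => le_rfl⟩
    · exact ⟨1, one_pos, fun h => absurd h hk⟩
  obtain ⟨b, hb0, hb1⟩ := hb
  have hev : ∀ᶠ x in 𝓝[>] (0:ℝ), 0 < w x * w 0 := by
    have hcont : Tendsto (fun x => w x * w 0) (𝓝[>] (0:ℝ)) (𝓝 (w 0 * w 0)) :=
      ((hw.mul continuous_const).tendsto 0).mono_left nhdsWithin_le_nhds
    exact hcont.eventually (lt_mem_nhds (mul_self_pos.2 h0))
  obtain ⟨e, he1, he2⟩ := (hev.and (Ioo_mem_nhdsGT hb0)).exists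
  refine ⟨fun i => if i = 0 then e else s i, ?_, ?_, ?_⟩
  · intro i hi
    by_cases h : i = 0
    · simp only [h, if_true]; exact he2.1
    · simp only [h, if_false]; exact hpos i (by omega) hi
  · intro i j hij hjk
    have hj : j ≠ 0 := by omega
    by_cases h : i = 0
    · simp only [h, if_true, hj, if_false]
      refine (he2.2.trans_le (hb1 (by omega))).trans_le ?_
      rcases (show 1 ≤ j by omega).eq_or_lt with rfl | h'
      · exact le_rfl
      · exact (h2 1 j h' hjk).le
    · simp only [h, hj, if_false]; exact h2 i j hij hjk
  · intro i hi
    have h3i := h3 i hi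
    by_cases h : i = 0
    · subst h
      simp only [if_true, zero_add, one_ne_zero, if_false] at h3i ⊢
      rw [← hs0] at h3i
      by_contra hcon
      push Not at hcon
      have hA := mul_nonneg he1.le hcon
      have e' : w e * w 0 * (w e * w (s 1)) = w e ^ 2 * (w 0 * w (s 1)) := by ring
      have hwe : 0 < w e ^ 2 := by
        have : w e ≠ 0 := fun hh => by rw [hh] at he1; simp at he1
        positivity
      nlinarith [mul_pos hwe (neg_pos.2 h3i)]
    · simp only [h, if_false, Nat.add_eq_zero_iff, one_ne_zero, and_false]
      exact h3i

lemma sc_min {w : ℝ → ℝ} {T : ℝ} (hT : 0 ≤ T) {k : ℕ} {s : ℕ → ℝ}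
    (h1 : ∀ i, i ≤ k → s i ∈ Ioi (0:ℝ)) (h2 : ∀ i j, i < j → j ≤ k → s i < s j)
    (h3 : ∀ i, i + 1 ≤ k → w (s i) * w (s (i+1)) < 0)
    (hlt : ∀ i, i + 1 ≤ k → s i < T)
    (hlast : T < s k → 0 < w T * w (s k)) : ChangesSignAtLeast w (Icc 0 T) k := by
  refine ⟨fun i => min (s i) T, fun i hi => ⟨le_min (le_of_lt (h1 i hi)) hT, min_le_right _ _⟩, ?_, ?_⟩
  · intro i j hij hjk
    have := hlt i (by omega)
    simp only
    rw [min_eq_left this.le]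
    exact lt_min (h2 i j hij hjk) this
  · intro i hi
    have hh := hlt i hi
    simp only
    rw [min_eq_left hh.le]
    rcases le_or_gt (s (i+1)) T with h | h
    · rw [min_eq_left h]; exact h3 i hi
    · rw [min_eq_right h.le]
      have hik : i + 1 = k := by
        by_contra hne
        exact absurd (hlt (i+1) (by omega)) (not_lt.2 h.le)
      have h4 := hlast (hik ▸ h)
      rw [← hik] at h4
      have h5 := h3 i hi
      rcases lt_trichotomy (w T) 0 with h6 | h6 | h6
      · have : w (s (i+1)) < 0 := by by_contra hcc; push Not at hcc; nlinarith
        nlinarith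
      · rw [h6] at h4; simp at h4
      · have : 0 < w (s (i+1)) := by by_contra hcc; push Not at hcc; nlinarith
        nlinarith

lemma sce_const {w : ℝ → ℝ} (hw : Continuous w) (h0 : w 0 ≠ 0) {T : ℝ} (hT : 0 ≤ T)
    (hpos : ∀ t, T ≤ t → 0 < w t) {k : ℕ} (hc : ChangesSignExactly w (Icc 0 T) k) :
    ChangesSignExactly w (Ioi 0) k := by
  refine ⟨sc_nudge hw h0 (sc_mono (fun x hx => hx.1) hc.1), fun hcon => hc.2 ?_⟩
  obtain ⟨s, h1, h2, h3⟩ := hcon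
  refine sc_min hT h1 h2 h3 (fun i hi => ?_) (fun h => mul_pos (hpos T le_rfl) (hpos _ h.le))
  by_contra hh
  push Not at hh
  have a1 := hpos _ hh
  have a2 := hpos _ (hh.trans (h2 i (i+1) (by omega) hi).le)
  have := h3 i hi
  nlinarith

lemma sc_append {w : ℝ → ℝ} {J : Set ℝ} {k : ℕ} {s : ℕ → ℝ} {x : ℝ}
    (h1 : ∀ i, i ≤ k → s i ∈ J) (h2 : ∀ i j, i < j → j ≤ k → s i < s j)
    (h3 : ∀ i, i + 1 ≤ k → w (s i) * w (s (i+1)) < 0) (hx : x ∈ J) (hk : s k < x)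
    (hw : w (s k) * w x < 0) : ChangesSignAtLeast w J (k+1) := by
  refine ⟨fun i => if i ≤ k then s i else x, ?_, ?_, ?_⟩
  · intro i hi
    by_cases h : i ≤ k
    · simp only [h, if_true]; exact h1 i h
    · simp only [h, if_false]; exact hx
  · intro i j hij hjk
    have hi : i ≤ k := by omega
    by_cases h : j ≤ k
    · simp only [h, hi, if_true]; exact h2 i j hij h
    · simp only [h, hi, if_true, if_false]
      rcases hi.eq_or_lt with rfl | h'
      · exact hk
      · exact (h2 i k h' le_rfl).trans hk
  · intro i hi
    have hi : i ≤ k := by omega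
    by_cases h : i + 1 ≤ k
    · simp only [h, hi, if_true]; exact h3 i h
    · have : i = k := by omega
      subst this
      simpa using hw

lemma sce_succ {w : ℝ → ℝ} (hw : Continuous w) (h0 : w 0 ≠ 0) {T : ℝ} (hT : 0 ≤ T)
    (hwT : 0 < w T) (hneg : ∃ t, T ≤ t ∧ w t < 0)
    (hpers : ∀ s, T ≤ s → w s < 0 → ∀ t, s ≤ t → w t < 0)
    {k : ℕ} (hc : ChangesSignExactly w (Icc 0 T) k) :
    ChangesSignExactly w (Ioi 0) (k+1) := by
  constructor
  · apply sc_nudge hw h0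
    obtain ⟨⟨s, h1, h2, h3⟩, hn⟩ := hc
    obtain ⟨r, hr, hwr⟩ := hneg
    have hTr : T < r := lt_of_le_of_ne hr (fun h => by rw [← h] at hwr; linarith)
    rcases Nat.eq_zero_or_pos k with rfl | hk
    · exact sc_append (k := 0) (s := fun _ => T) (x := r) (fun i _ => hT) (fun i j _ _ => by omega)
        (fun i _ => by omega) (hT.trans hr) hTr (by nlinarith)
    · have hne : w (s k) ≠ 0 := fun hh => by
        have := h3 (k-1) (by omega)
        rw [Nat.sub_add_cancel hk, hh] at this
        simp at this
      rcases lt_or_gt_of_ne hne with h | h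
      · exfalso
        apply hn
        have hsT : s k < T := lt_of_le_of_ne (h1 k le_rfl).2 (fun hh => by rw [hh] at h; linarith)
        exact sc_append h1 h2 h3 ⟨hT, le_rfl⟩ hsT (by nlinarith)
      · exact sc_append (J := Ici 0) (fun i hi => (h1 i hi).1) h2 h3 (hT.trans hr)
          ((h1 k le_rfl).2.trans_lt hTr) (by nlinarith)
  · rintro ⟨s, h1, h2, h3⟩
    apply hc.2
    have hmain : ∀ i, i + 1 ≤ k + 2 → T ≤ s i → 0 < w (s i) := by
      intro i hi hTi
      by_contra hcon
      push Not at hcon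
      have h4 := h3 i hi
      have h5 : w (s i) < 0 := lt_of_le_of_ne hcon (fun hh => by rw [hh] at h4; simp at h4)
      have h6 := hpers _ hTi h5 _ (h2 i (i+1) (by omega) hi).le
      nlinarith
    refine sc_min hT (fun i hi => h1 i (by omega)) (fun i j hij hj => h2 i j hij (by omega))
      (fun i hi => h3 i (by omega)) (fun i hi => ?_) (fun h => mul_pos hwT (hmain _ (by omega) h.le))
    by_contra hh
    push Not at hh
    have a1 := hmain i (by omega) hh
    have a2 := hmain (i+1) (by omega) (hh.trans (h2 i (i+1) (by omega) (by omega)).le)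
    have := h3 i (by omega)
    nlinarith

lemma solA_of {m : ℕ} {u v : ℝ → ℝ} (h : IsSolS2 m u v) :
    SolA (((m:ℝ) - 2) / 2) (1 / ((m:ℝ) - 1)) u v := by
  intro t
  have := h t
  rw [neg_div] at this
  exact this

lemma HA_of {m : ℕ} (hm : 3 ≤ m) (u v : ℝ → ℝ) (t : ℝ) :
    H2 m t (u t) (v t) = HA (((m:ℝ) - 2) / 2) (1 / ((m:ℝ) - 1)) u v t := by
  have hm' : (3:ℝ) ≤ m := by exact_mod_cast hm
  have h1 : (m:ℝ) - 1 ≠ 0 := by linarith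
  have h2 : (m:ℝ) ≠ 0 := by linarith
  have e1 : 1 / ((m:ℝ) - 1) + 1 = m / ((m:ℝ) - 1) := by field_simp; ring
  unfold H2 HA KA
  rw [neg_div, e1]
  have e2 : ((m:ℝ) - 1) / (2 * m) = 1 / (2 * (m / ((m:ℝ) - 1))) := by field_simp
  rw [e2]
  ring

lemma SolA.neg {a p : ℝ} {u v : ℝ → ℝ} (S : SolA a p u v) :
    SolA a p (fun t => - u t) (fun t => - v t) := by
  intro t
  have e : zzA p (fun t => - u t) (fun t => - v t) t = zzA p u v t := by simp [zzA]
  rw [e]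
  exact ⟨(S t).1.neg.congr_deriv (by ring), (S t).2.neg.congr_deriv (by ring)⟩

lemma HA_neg (a p : ℝ) (u v : ℝ → ℝ) (t : ℝ) :
    HA a p (fun t => - u t) (fun t => - v t) t = HA a p u v t := by
  simp [HA, KA]

lemma SolA.refl {a p : ℝ} {u v : ℝ → ℝ} (S : SolA a p u v) :
    SolA a p (fun t => v (-t)) (fun t => u (-t)) := by
  intro t
  have e : zzA p (fun t => v (-t)) (fun t => u (-t)) t = zzA p u v (-t) := by
    simp [zzA, add_comm]
  rw [e]
  have h1 := (S (-t)).1.scomp t (hasDerivAt_neg t)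
  have h2 := (S (-t)).2.scomp t (hasDerivAt_neg t)
  exact ⟨h2.congr_deriv (by simp), h1.congr_deriv (by simp)⟩

lemma SolA.even {a p : ℝ} (ha : 0 ≤ a) (hp : 0 < p) (hp1 : p ≤ 1) {u v : ℝ → ℝ}
    (S : SolA a p u v) (h0 : 0 < (u 0)^2 + (v 0)^2) (huv : u 0 = v 0) {t : ℝ} (ht : 0 ≤ t) :
    v (-t) = u t ∧ u (-t) = v t :=
  SolA.unique ha hp hp1 S S.refl h0 (by simp [huv]) (by simp [huv]) ht

lemma HA_even {a p : ℝ} (ha : 0 ≤ a) (hp : 0 < p) (hp1 : p ≤ 1) {u v : ℝ → ℝ}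
    (S : SolA a p u v) (h0 : 0 < (u 0)^2 + (v 0)^2) (huv : u 0 = v 0) {t : ℝ} (ht : 0 ≤ t) :
    HA a p u v (-t) = HA a p u v t := by
  obtain ⟨h1, h2⟩ := S.even ha hp hp1 h0 huv ht
  simp only [HA, KA, h1, h2, Real.cosh_neg]
  rw [add_comm ((v t)^2), mul_comm (v t)]

lemma neg_limit {m : ℕ} {u v : ℝ → ℝ} (hanti : ∀ s t, 0 ≤ s → s ≤ t →
      H2 m t (u t) (v t) ≤ H2 m s (u s) (v s))
    (heven : ∀ t, 0 ≤ t → H2 m (-t) (u (-t)) (v (-t)) = H2 m t (u t) (v t))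
    (hneg : ∃ t, 0 ≤ t ∧ H2 m t (u t) (v t) < 0) : EnergyNegLimit m u v := by
  unfold EnergyNegLimit
  set F : ℝ → ℝ := fun t => H2 m t (u t) (v t) with hF
  have hG : Antitone (fun t => F (max t 0)) := fun s t hst =>
    hanti _ _ (le_max_right _ _) (max_le_max hst le_rfl)
  have hEq : (fun t => F (max t 0)) =ᶠ[atTop] F := by
    filter_upwards [eventually_ge_atTop 0] with t ht
    rw [max_eq_left ht]
  have hbot : ∀ l : Filter ℝ, Tendsto F atTop l → Tendsto F atBot l := by
    intro l hl
    have h1 := hl.comp tendsto_neg_atBot_atTop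
    refine h1.congr' ?_
    filter_upwards [eventually_le_atBot 0] with t ht
    have := heven (-t) (by linarith)
    simp only [neg_neg] at this
    simp only [Function.comp, hF]
    exact this.symm
  rcases tendsto_atTop_of_antitone hG with h | ⟨L, h⟩
  · have h' := h.congr' hEq
    exact Or.inr ⟨h', hbot _ h'⟩
  · have h' := h.congr' hEq
    refine Or.inl ⟨L, ?_, h', hbot _ h'⟩
    obtain ⟨t, ht, htn⟩ := hneg
    refine lt_of_le_of_lt (le_of_tendsto h' ?_) htn
    filter_upwards [eventually_ge_atTop t] with s hs
    exact hanti t s ht hs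

theorem stmt17 (m : ℕ) (hm : 3 ≤ m) :
    ∃ C₀ : ℝ, 0 < C₀ ∧
      ∀ (μ : ℝ) (k : ℕ) (T : ℝ), 0 < μ → 1 < T →
        ∀ u v : ℝ → ℝ, IsSolS2 m u v → u 0 = μ → v 0 = μ →
          H2 m T (u T) (v T) ≤ C₀ →
          0 < u T * v T →
          ChangesSignExactly v (Set.Icc 0 T) k →
          μ ∈ setA m k ∪ setI m k ∪ setA m (k + 1) := by
  have hm' : (3:ℝ) ≤ m := by exact_mod_cast hm
  have hHA := fun u v t => HA_of hm u v t
  have hSA : ∀ u v, IsSolS2 m u v → _ := fun u v => solA_of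
  set a := ((m:ℝ) - 2) / 2 with ha_def
  set p := 1 / ((m:ℝ) - 1) with hp_def
  have ha : 1 / 2 ≤ a := by rw [ha_def]; linarith
  have ha0 : 0 < a := by linarith
  have hp : 0 < p := by rw [hp_def]; apply one_div_pos.2; linarith
  have hp1 : p ≤ 1 := by
    rw [hp_def, div_le_one (by linarith)]; linarith
  refine ⟨C0A a p, C0A_pos ha0 hp, ?_⟩
  intro μ k T hμ hT u v hsol hu0 hv0 hH huv hk
  have S : SolA a p u v := hSA u v hsol
  have h0 : 0 < (u 0)^2 + (v 0)^2 := by rw [hu0]; positivity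
  have hR := S.R_pos ha0.le h0
  have hT0 : 0 ≤ T := by linarith
  have hv0' : v 0 ≠ 0 := by rw [hv0]; exact hμ.ne'
  have huv0 : u 0 = v 0 := by rw [hu0, hv0]
  have hNL : (∃ t, T ≤ t ∧ HA a p u v t < 0) → EnergyNegLimit m u v := by
    rintro ⟨t, ht, htn⟩
    apply neg_limit
    · intro s t hs hst
      rw [hHA, hHA]; exact S.H_le hp hs hst
    · intro t ht
      rw [hHA, hHA]; exact HA_even ha0.le hp hp1 S h0 huv0 ht
    · exact ⟨t, hT0.trans ht, by rw [hHA]; exact htn⟩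
  have hI : ChangesSignExactly v (Ioi 0) k → (∀ t, T ≤ t → 0 < HA a p u v t) →
      (∀ t, T ≤ t → (u t)^2 + (v t)^2 ≤ (u T)^2 + (v T)^2) → μ ∈ setI m k := by
    intro h1 h2 h3
    have hpos : ∀ t, 0 ≤ t → 0 < HA a p u v t := by
      intro t ht
      rcases le_total T t with h | h
      · exact h2 t h
      · exact (h2 T le_rfl).trans_le (S.H_le hp ht h)
    obtain ⟨B, hB⟩ := (isCompact_Icc (a := (0:ℝ)) (b := T)).bddAbove_image
      ((S.cont_u.pow 2).add (S.cont_v.pow 2)).continuousOn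
    have hB' : ∀ t, 0 ≤ t → (u t)^2 + (v t)^2 ≤ B := by
      intro t ht
      have hBT : (u T)^2 + (v T)^2 ≤ B := hB ⟨T, ⟨hT0, le_rfl⟩, rfl⟩
      rcases le_total T t with h | h
      · exact (h3 t h).trans hBT
      · exact hB ⟨t, ⟨ht, h⟩, rfl⟩
    have hM : ∀ t, 0 ≤ t → |u t| + |v t| ≤ 1 + B := by
      intro t ht
      have := hB' t ht
      nlinarith [sq_abs (u t), sq_abs (v t), sq_nonneg (|u t| - 1/2), sq_nonneg (|v t| - 1/2)]
    refine ⟨hμ, u, v, hsol, hu0, hv0, h1, fun t => ?_, 1 + B, fun t => ?_⟩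
    · rw [hHA]
      rcases le_total 0 t with h | h
      · exact hpos t h
      · have := HA_even ha0.le hp hp1 S h0 huv0 (t := -t) (by linarith)
        rw [neg_neg] at this
        rw [this]; exact hpos _ (by linarith)
    · rcases le_total 0 t with h | h
      · exact hM t h
      · have := S.even ha0.le hp hp1 h0 huv0 (t := -t) (by linarith)
        rw [neg_neg] at this
        rw [this.1, this.2, add_comm]; exact hM _ (by linarith)
  rw [hHA] at hH
  rcases pos_and_pos_or_neg_and_neg_of_mul_pos huv with ⟨huT, hvT⟩ | ⟨huT, hvT⟩
  · rcases S.main ha hp hp1 hR hT hH huT hvT with ⟨h1, h2⟩ | ⟨h1, h2, h3⟩ | ⟨h1, h2, h3⟩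
    · exact Or.inl (Or.inl ⟨hμ, u, v, hsol, hu0, hv0, sce_const S.cont_v hv0' hT0 h1 hk, hNL h2⟩)
    · exact Or.inl (Or.inr (hI (sce_const S.cont_v hv0' hT0 h1 hk) h2 h3))
    · exact Or.inr ⟨hμ, u, v, hsol, hu0, hv0, sce_succ S.cont_v hv0' hT0 hvT h1 h2 hk, hNL h3⟩
  · have hv0n : -v 0 ≠ 0 := neg_ne_zero.2 hv0'
    have hkn := sce_neg.2 hk
    rcases S.neg.main ha hp hp1 (fun t ht => by simpa using hR t ht) hT (by rw [HA_neg]; exact hH)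
      (neg_pos.2 huT) (neg_pos.2 hvT) with ⟨h1, h2⟩ | ⟨h1, h2, h3⟩ | ⟨h1, h2, h3⟩
    · simp only [HA_neg] at h2
      exact Or.inl (Or.inl ⟨hμ, u, v, hsol, hu0, hv0,
        sce_neg.1 (sce_const S.neg.cont_v hv0n hT0 h1 hkn), hNL h2⟩)
    · simp only [HA_neg] at h2
      simp only [neg_sq] at h3
      exact Or.inl (Or.inr (hI (sce_neg.1 (sce_const S.neg.cont_v hv0n hT0 h1 hkn)) h2 h3))
    · simp only [HA_neg] at h3
      exact Or.inr ⟨hμ, u, v, hsol, hu0, hv0,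
        sce_neg.1 (sce_succ S.neg.cont_v hv0n hT0 (neg_pos.2 hvT) h1 h2 hkn), hNL h3⟩
end
end

section
/- For every k ∈ ℕ ∪ {0} the following hold: (1) A_k is an open subset of (0,+∞); (2) if μ ∈ I_k, then there exists ε > 0 such that (μ−ε, μ+ε) ⊂ A_k ∪ I_k ∪ A_{k+1}; (3) if A_k is nonempty and bounded, then sup A_k ∈ I_k; (4) if both A_k and I_k are bounded and μ = sup I_k, then μ ∈ I_k and there exists ε > 0 such that (μ, μ+ε) ⊂ A_{k+1}. -/
open Real Filter Set Topology

noncomputable section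

set_option linter.unusedVariables false

/-- Polar form of the system: `θ' = a sin 2θ - e^L`, `L' = -2ap cos 2θ - p tanh t`. -/
def PS (a p : ℝ) (θ L : ℝ → ℝ) : Prop :=
  ∀ t : ℝ, HasDerivAt θ (a * sin (2 * θ t) - exp (L t)) t ∧
    HasDerivAt L (-(2 * a * p) * cos (2 * θ t) - p * tanh t) t

/-- sign of the energy -/
def GG (a p : ℝ) (θ L : ℝ → ℝ) (t : ℝ) : ℝ := exp (L t) - a * (1 + p) * sin (2 * θ t)

/-- rescaled energy -/
def FF (a p n : ℝ) (θ L : ℝ → ℝ) (t : ℝ) : ℝ := exp (n * L t) * GG a p θ L t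

theorem PS.contθ {a p : ℝ} {θ L : ℝ → ℝ} (h : PS a p θ L) : Continuous θ :=
  continuous_iff_continuousAt.2 fun t => (h t).1.continuousAt

theorem PS.contL {a p : ℝ} {θ L : ℝ → ℝ} (h : PS a p θ L) : Continuous L :=
  continuous_iff_continuousAt.2 fun t => (h t).2.continuousAt

theorem PS.contG {a p : ℝ} {θ L : ℝ → ℝ} (h : PS a p θ L) : Continuous (GG a p θ L) := by
  have := h.contθ
  have := h.contL
  unfold GG
  fun_prop

theorem PS.derivF {a p n : ℝ} (hnp : n * p = 1) {θ L : ℝ → ℝ} (h : PS a p θ L) (t : ℝ) :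
    HasDerivAt (FF a p n θ L)
      ((1 + p) * tanh t * exp (n * L t) * (a * sin (2 * θ t) - exp (L t))) t := by
  have h1 := (h t).1
  have h2 := (h t).2
  have hG : HasDerivAt (GG a p θ L) _ t :=
    h2.exp.sub (((h1.const_mul 2).sin).const_mul (a * (1 + p)))
  have hF : HasDerivAt (FF a p n θ L) _ t := ((h2.const_mul n).exp).mul hG
  refine hF.congr_deriv ?_
  unfold GG
  have e : n * (-(2 * a * p) * cos (2 * θ t) - p * tanh t) = - 2 * a * cos (2 * θ t) - tanh t := by
    linear_combination (-2 * a * cos (2 * θ t) - tanh t) * hnp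
  rw [e]
  ring

theorem PS.derivH {a p n : ℝ} (hnp : n * p = 1) {θ L : ℝ → ℝ} (h : PS a p θ L) (t : ℝ) :
    HasDerivAt (fun t => cosh t * FF a p n θ L t)
      (- (p * sinh t * exp (n * L t) * exp (L t))) t := by
  refine ((Real.hasDerivAt_cosh t).mul (h.derivF hnp t)).congr_deriv ?_
  rw [Real.tanh_eq_sinh_div_cosh]
  unfold FF GG
  have := (Real.cosh_pos t).ne'
  field_simp
  ring

theorem PS.anti {a p n : ℝ} (hp : 0 < p) (hnp : n * p = 1) {θ L : ℝ → ℝ} (h : PS a p θ L) :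
    StrictAntiOn (fun t => cosh t * FF a p n θ L t) (Ici 0) := by
  refine strictAntiOn_of_deriv_neg (convex_Ici 0)
    (fun t _ => (h.derivH hnp t).continuousAt.continuousWithinAt) ?_
  intro t ht
  rw [interior_Ici] at ht
  rw [(h.derivH hnp t).deriv]
  have : 0 < sinh t := Real.sinh_pos_iff.2 ht
  have : 0 < p * sinh t * exp (n * L t) * exp (L t) := by positivity
  linarith

theorem FF_pos_iff {a p n : ℝ} {θ L : ℝ → ℝ} {t : ℝ} :
    0 < cosh t * FF a p n θ L t ↔ 0 < GG a p θ L t := by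
  unfold FF
  rw [mul_pos_iff_of_pos_left (Real.cosh_pos t), mul_pos_iff_of_pos_left (exp_pos _)]

theorem FF_neg_iff {a p n : ℝ} {θ L : ℝ → ℝ} {t : ℝ} :
    cosh t * FF a p n θ L t < 0 ↔ GG a p θ L t < 0 := by
  unfold FF
  rw [← not_le, ← not_le, mul_nonneg_iff_of_pos_left (Real.cosh_pos t),
    mul_nonneg_iff_of_pos_left (exp_pos _)]

theorem PS.G_neg {a p : ℝ} (hp : 0 < p) {θ L : ℝ → ℝ} (h : PS a p θ L)
    {s t : ℝ} (hs : 0 ≤ s) (hst : s < t) (hG : GG a p θ L s ≤ 0) : GG a p θ L t < 0 := by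
  have hnp : p⁻¹ * p = 1 := inv_mul_cancel₀ hp.ne'
  have := h.anti hp hnp (mem_Ici.2 hs) (mem_Ici.2 (hs.trans hst.le)) hst
  rw [← FF_neg_iff (n := p⁻¹)]
  have h2 : ¬ 0 < cosh s * FF a p p⁻¹ θ L s := by
    rw [FF_pos_iff]; exact not_lt.2 hG
  simp only at this
  linarith

theorem PS.G_neg' {a p : ℝ} (hp : 0 < p) {θ L : ℝ → ℝ} (h : PS a p θ L)
    {s t : ℝ} (hs : 0 ≤ s) (hst : s ≤ t) (hG : GG a p θ L s < 0) : GG a p θ L t < 0 := by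
  rcases hst.eq_or_lt with rfl | h1
  · exact hG
  · exact h.G_neg hp hs h1 hG.le

theorem sin_two_int (j : ℤ) (x : ℝ) : sin (2 * (x + j * π)) = sin (2 * x) := by
  rw [show 2 * (x + j * π) = 2 * x + j * (2 * π) by ring, Real.sin_add_int_mul_two_pi]

theorem cos_two_int (j : ℤ) (x : ℝ) : cos (2 * (x + j * π)) = cos (2 * x) := by
  rw [show 2 * (x + j * π) = 2 * x + j * (2 * π) by ring, Real.cos_add_int_mul_two_pi]

theorem PS.barrier {a p : ℝ} {θ L : ℝ → ℝ} (h : PS a p θ L) (j : ℤ)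
    {s t : ℝ} (hst : s < t) (hs : θ s ≤ j * π) : θ t < j * π := by
  have key : ∀ x, θ x = j * π → a * sin (2 * θ x) - exp (L x) < 0 := by
    intro x hx
    have := sin_two_int j 0
    rw [zero_add] at this
    rw [hx, this]
    simp [exp_pos]
  have le : ∀ x, s ≤ x → θ x ≤ j * π := by
    intro x hx
    exact image_le_of_deriv_right_lt_deriv_boundary (f := θ) (a := s) (b := x)
      (B := fun _ => j * π) (B' := fun _ => 0) h.contθ.continuousOn
      (fun y _ => (h y).1.hasDerivWithinAt) hs (fun y => hasDerivAt_const y _)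
      (fun y _ hy => key y hy) (right_mem_Icc.2 hx)
  refine lt_of_le_of_ne (le t hst.le) fun heq => ?_
  have hloc : IsLocalMax θ t := by
    filter_upwards [Ioi_mem_nhds hst] with x hx
    rw [heq]
    exact le x (le_of_lt hx)
  have := hloc.hasDerivAt_eq_zero (h t).1
  have := key t heq
  linarith

theorem PS.θ'_le {a p : ℝ} (ha : 1 / 2 ≤ a) (hp : 0 < p) {θ L : ℝ → ℝ} {t : ℝ}
    (hG : 0 ≤ GG a p θ L t) :
    a * sin (2 * θ t) - exp (L t) ≤ - (a * p * |sin (2 * θ t)|) ∨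
    a * sin (2 * θ t) - exp (L t) ≤ - (a * |sin (2 * θ t)|) := by
  unfold GG at hG
  rcases le_total 0 (sin (2 * θ t)) with h | h
  · left; rw [abs_of_nonneg h]; linarith
  · right; rw [abs_of_nonpos h]; have := exp_pos (L t); linarith

theorem PS.θ'_nonpos {a p : ℝ} (ha : 1 / 2 ≤ a) (hp : 0 < p) {θ L : ℝ → ℝ} {t : ℝ}
    (hG : 0 ≤ GG a p θ L t) :
    a * sin (2 * θ t) - exp (L t) ≤ 0 := by
  have h1 : 0 ≤ a * |sin (2 * θ t)| := by positivity
  have h2 : 0 ≤ a * p * |sin (2 * θ t)| := by positivity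
  rcases PS.θ'_le ha hp hG with h | h <;> linarith

theorem PS.θ_anti {a p : ℝ} (ha : 1 / 2 ≤ a) (hp : 0 < p) {θ L : ℝ → ℝ} (h : PS a p θ L)
    {D : Set ℝ} (hD : Convex ℝ D) (hG : ∀ t ∈ D, 0 ≤ GG a p θ L t) : AntitoneOn θ D := by
  refine antitoneOn_of_deriv_nonpos hD h.contθ.continuousOn
    (fun x _ => (h x).1.differentiableAt.differentiableWithinAt) fun x hx => ?_
  rw [(h x).1.deriv]
  exact PS.θ'_nonpos ha hp (hG x (interior_subset hx))


theorem PS.no_drop {a p : ℝ} {θ L : ℝ → ℝ} (h : PS a p θ L) {B c T : ℝ} (hc : 0 < c)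
    (hT : ∀ t, T ≤ t → a * sin (2 * θ t) - exp (L t) ≤ -c) (hB : ∀ t, T ≤ t → B ≤ θ t) : False := by
  have hd : ∀ t, HasDerivAt (fun t => θ t + c * t) (a * sin (2 * θ t) - exp (L t) + c * 1) t :=
    fun t => (h t).1.add ((hasDerivAt_id t).const_mul c)
  have hanti : AntitoneOn (fun t => θ t + c * t) (Ici T) := by
    refine antitoneOn_of_deriv_nonpos (convex_Ici T)
      (fun t _ => (hd t).continuousAt.continuousWithinAt)
      (fun t _ => (hd t).differentiableAt.differentiableWithinAt) fun t ht => ?_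
    rw [(hd t).deriv]
    have := hT t (interior_subset ht)
    linarith
  have h0 : 0 ≤ (θ T - B) / c := div_nonneg (by linarith [hB T le_rfl]) hc.le
  have h1 := hanti (mem_Ici.2 le_rfl) (mem_Ici.2 (show T ≤ T + (θ T - B) / c + 1 by linarith))
    (by linarith)
  have h2 := hB (T + (θ T - B) / c + 1) (by linarith)
  simp only at h1
  have : c * (T + (θ T - B) / c + 1) = c * T + (θ T - B) + c := by
    field_simp
  linarith

theorem PS.key {a p n : ℝ} (ha : 1 / 2 ≤ a) (hp : 0 < p) (hnp : n * p = 1) {θ L : ℝ → ℝ}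
    (h : PS a p θ L) (hG : ∀ t, 0 ≤ t → 0 ≤ GG a p θ L t) {B : ℝ} (hB : ∀ t, 0 ≤ t → B ≤ θ t) :
    ∃ j : ℤ, Tendsto θ atTop (𝓝 (j * π)) ∧ (∀ t, 0 ≤ t → j * π < θ t) ∧
      (∀ δ : ℝ, 0 < δ → ∀ᶠ t in atTop, FF a p n θ L t < δ) ∧
      ∃ M : ℝ, ∀ t, 0 ≤ t → cosh t * exp (n * L t) ≤ M := by
  have hn : 0 < n := by
    by_contra hcon
    have := mul_nonpos_of_nonpos_of_nonneg (not_lt.1 hcon) hp.le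
    linarith
  have hanti : AntitoneOn θ (Ici 0) := h.θ_anti ha hp (convex_Ici 0) hG
  obtain ⟨l, hl⟩ : ∃ l, Tendsto θ atTop (𝓝 l) := by
    have hmono : Antitone fun t => θ (max t 0) := fun x y hxy =>
      hanti (mem_Ici.2 (le_max_right _ _)) (mem_Ici.2 (le_max_right _ _)) (max_le_max_right 0 hxy)
    have heq : (fun t => θ (max t 0)) =ᶠ[atTop] θ := by
      filter_upwards [eventually_ge_atTop 0] with t ht
      rw [max_eq_left ht]
    rcases tendsto_atTop_of_antitone hmono with h1 | ⟨l, h1⟩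
    · exfalso
      obtain ⟨t, ht⟩ := (h1.eventually (eventually_lt_atBot B)).exists
      exact absurd (hB (max t 0) (le_max_right _ _)) (not_le.2 ht)
    · exact ⟨l, h1.congr' heq⟩
  have hge : ∀ t, 0 ≤ t → l ≤ θ t := by
    intro t ht
    refine le_of_tendsto hl ?_
    filter_upwards [eventually_ge_atTop t] with s hs
    exact hanti (mem_Ici.2 ht) (mem_Ici.2 (ht.trans hs)) hs
  have hsin : sin (2 * l) = 0 := by
    by_contra hne
    have hpos : 0 < |sin (2 * l)| := abs_pos.2 hne
    have ht : Tendsto (fun t => |sin (2 * θ t)|) atTop (𝓝 |sin (2 * l)|) :=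
      ((Real.continuous_sin.tendsto _).comp (hl.const_mul 2)).abs
    obtain ⟨T, hT⟩ := eventually_atTop.1 ((ht.eventually
      (lt_mem_nhds (half_lt_self hpos))).and (eventually_ge_atTop 0))
    have hc : 0 < min (a * p) a * (|sin (2 * l)| / 2) := by positivity
    refine h.no_drop (T := T) (B := B) hc (fun t htt => ?_) (fun t htt => hB t (hT t htt).2)
    obtain ⟨h1, h2⟩ := hT t htt
    have e1 : min (a * p) a * (|sin (2 * l)| / 2) ≤ a * p * |sin (2 * θ t)| :=
      mul_le_mul (min_le_left _ _) h1.le (by positivity) (by positivity)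
    have e2 : min (a * p) a * (|sin (2 * l)| / 2) ≤ a * |sin (2 * θ t)| :=
      mul_le_mul (min_le_right _ _) h1.le (by positivity) (by positivity)
    rcases PS.θ'_le ha hp (hG t h2) with h3 | h3 <;> linarith
  obtain ⟨N, hN⟩ := Real.sin_eq_zero_iff.1 hsin
  obtain ⟨j, hj | hj⟩ := N.even_or_odd'
  swap
  · -- odd case
    exfalso
    have hl' : l = (j * π) + π / 2 := by
      rw [hj] at hN; push_cast at hN; linarith
    have hs : ∀ t, sin (2 * θ t) = - sin (2 * (θ t - l)) := by
      intro t
      rw [show 2 * θ t = 2 * ((θ t - l + π / 2) + j * π) by rw [hl']; ring, sin_two_int,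
        show 2 * (θ t - l + π / 2) = 2 * (θ t - l) + π by ring, Real.sin_add_pi]
    have hcs : ∀ t, cos (2 * θ t) = - cos (2 * (θ t - l)) := by
      intro t
      rw [show 2 * θ t = 2 * ((θ t - l + π / 2) + j * π) by rw [hl']; ring, cos_two_int,
        show 2 * (θ t - l + π / 2) = 2 * (θ t - l) + π by ring, Real.cos_add_pi]
    obtain ⟨T, hT⟩ := eventually_atTop.1 ((hl.eventually
      (gt_mem_nhds (show l < l + π / 4 by linarith [Real.pi_pos]))).and (eventually_ge_atTop 0))
    have hd : ∀ t, HasDerivAt (fun t => L t - 2 * p * θ t) _ t :=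
      fun t => (h t).2.sub ((h t).1.const_mul (2 * p))
    have hmono : MonotoneOn (fun t => L t - 2 * p * θ t) (Ici T) := by
      refine monotoneOn_of_deriv_nonneg (convex_Ici T)
        (fun t _ => (hd t).continuousAt.continuousWithinAt)
        (fun t _ => (hd t).differentiableAt.differentiableWithinAt) fun t ht => ?_
      have ht' := interior_subset ht
      rw [(hd t).deriv, hs, hcs]
      obtain ⟨h1, h2⟩ := hT t ht'
      have h3 := hge t h2
      have c0 : 0 ≤ cos (2 * (θ t - l)) := Real.cos_nonneg_of_neg_pi_div_two_le_of_le
        (by linarith [Real.pi_pos]) (by linarith)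
      have s0 : 0 ≤ sin (2 * (θ t - l)) := Real.sin_nonneg_of_nonneg_of_le_pi
        (by linarith) (by linarith [Real.pi_pos])
      have e1 := Real.sin_sq_add_cos_sq (2 * (θ t - l))
      have c1 := Real.cos_le_one (2 * (θ t - l))
      have s1 := Real.sin_le_one (2 * (θ t - l))
      have e2 : 1 ≤ sin (2 * (θ t - l)) + cos (2 * (θ t - l)) := by nlinarith
      have e3 := Real.tanh_lt_one t
      have e4 := exp_pos (L t)
      have e5 : p * tanh t ≤ p := by nlinarith
      have e6 : p * 1 ≤ p * ((2 * a) * (sin (2 * (θ t - l)) + cos (2 * (θ t - l)))) := by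
        apply mul_le_mul_of_nonneg_left _ hp.le
        nlinarith
      have e7 : 0 ≤ p * exp (L t) := by positivity
      nlinarith
    refine h.no_drop (T := T) (B := B) (exp_pos (L T - 2 * p * θ T + 2 * p * l))
      (fun t htt => ?_) (fun t htt => hB t (hT t htt).2)
    obtain ⟨h1, h2⟩ := hT t htt
    have h3 := hge t h2
    have s0 : 0 ≤ sin (2 * (θ t - l)) := Real.sin_nonneg_of_nonneg_of_le_pi
        (by linarith) (by linarith [Real.pi_pos])
    have h4 := hmono (mem_Ici.2 le_rfl) (mem_Ici.2 htt) htt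
    simp only at h4
    have h5 : exp (L T - 2 * p * θ T + 2 * p * l) ≤ exp (L t) := by
      apply exp_le_exp.2
      have : 2 * p * l ≤ 2 * p * θ t := by gcongr
      linarith
    rw [hs]
    nlinarith
  · have hl' : l = j * π := by
      rw [hj] at hN; push_cast at hN; linarith
    subst hl'
    have hct : Tendsto (fun t => cos (2 * θ t)) atTop (𝓝 1) := by
      have := (Real.continuous_cos.tendsto _).comp (hl.const_mul 2)
      have e := cos_two_int j 0
      rw [zero_add, mul_zero, Real.cos_zero] at e
      rwa [e] at this
    obtain ⟨T, hT⟩ := eventually_atTop.1 ((hct.eventually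
      (lt_mem_nhds (show (1 / 2 : ℝ) < 1 by norm_num))).and (eventually_ge_atTop 0))
    have hT0 : 0 ≤ T := (hT T le_rfl).2
    have hdL : ∀ t, HasDerivAt (fun t => L t + a * p * t)
        (-(2 * a * p) * cos (2 * θ t) - p * tanh t + a * p * 1) t :=
      fun t => (h t).2.add ((hasDerivAt_id t).const_mul (a * p))
    have hLa : AntitoneOn (fun t => L t + a * p * t) (Ici T) := by
      refine antitoneOn_of_deriv_nonpos (convex_Ici T)
        (fun t _ => (hdL t).continuousAt.continuousWithinAt)
        (fun t _ => (hdL t).differentiableAt.differentiableWithinAt) fun t ht => ?_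
      obtain ⟨h1, h2⟩ := hT t (interior_subset ht)
      rw [(hdL t).deriv]
      have e1 : 0 ≤ p * tanh t := by
        rw [Real.tanh_eq_sinh_div_cosh]
        have := Real.sinh_nonneg_iff.2 h2
        have := Real.cosh_pos t
        positivity
      have e2 : 2 * a * p * (1 / 2) ≤ 2 * a * p * cos (2 * θ t) := by gcongr
      linarith
    have hLt : Tendsto L atTop atBot := by
      have hap : 0 < a * p := by positivity
      have : Tendsto (fun t => L T + a * p * T - a * p * t) atTop atBot := by
        apply tendsto_atBot_add_const_left
        exact tendsto_neg_atTop_atBot.comp (tendsto_id.const_mul_atTop hap)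
      refine tendsto_atBot_mono' _ ?_ this
      filter_upwards [eventually_ge_atTop T] with t ht
      have := hLa (mem_Ici.2 le_rfl) (mem_Ici.2 ht) ht
      simp only at this
      linarith
    refine ⟨j, hl, ?_, ?_, ?_⟩
    · intro t ht
      refine lt_of_le_of_ne (hge t ht) fun heq => ?_
      have h1 := h.barrier j (lt_add_one t) heq.symm.le
      have h2 := hge (t + 1) (by linarith)
      linarith
    · intro δ hδ
      have e1 : Tendsto (fun t => exp (n * L t)) atTop (𝓝 0) :=
        Real.tendsto_exp_atBot.comp (hLt.const_mul_atBot hn)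
      have e2 : Tendsto (fun t => exp (L t)) atTop (𝓝 0) := Real.tendsto_exp_atBot.comp hLt
      have e3 : Tendsto (fun t => exp (n * L t) * (exp (L t) + a * (1 + p))) atTop (𝓝 0) := by
        have := e1.mul (e2.add_const (a * (1 + p)))
        rwa [zero_mul] at this
      filter_upwards [e3.eventually (gt_mem_nhds hδ)] with t ht
      refine lt_of_le_of_lt ?_ ht
      unfold FF GG
      have := Real.neg_one_le_sin (2 * θ t)
      have hb : 0 ≤ a * (1 + p) := by positivity
      gcongr
      nlinarith
    · have hr : ∀ t, HasDerivAt (fun t => cosh t * exp (n * L t))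
          (- (2 * a * cos (2 * θ t) * (cosh t * exp (n * L t)))) t := by
        intro t
        refine ((Real.hasDerivAt_cosh t).mul (((h t).2.const_mul n).exp)).congr_deriv ?_
        have e : n * (-(2 * a * p) * cos (2 * θ t) - p * tanh t)
            = - 2 * a * cos (2 * θ t) - tanh t := by
          linear_combination (-2 * a * cos (2 * θ t) - tanh t) * hnp
        rw [e, Real.tanh_eq_sinh_div_cosh]
        have := (Real.cosh_pos t).ne'
        field_simp
        ring
      have hcont : Continuous fun t => cosh t * exp (n * L t) :=
        continuous_iff_continuousAt.2 fun t => (hr t).continuousAt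
      have hra : AntitoneOn (fun t => cosh t * exp (n * L t)) (Ici T) := by
        refine antitoneOn_of_deriv_nonpos (convex_Ici T) hcont.continuousOn
          (fun t _ => (hr t).differentiableAt.differentiableWithinAt) fun t ht => ?_
        obtain ⟨h1, h2⟩ := hT t (interior_subset ht)
        rw [(hr t).deriv]
        have := Real.cosh_pos t
        have h3 : 0 ≤ cos (2 * θ t) := by linarith
        have : 0 ≤ 2 * a * cos (2 * θ t) * (cosh t * exp (n * L t)) := by positivity
        linarith
      obtain ⟨M, hM⟩ := (isCompact_Icc (a := 0) (b := T)).bddAbove_image hcont.continuousOn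
      refine ⟨M, fun t ht => ?_⟩
      rcases le_total t T with h1 | h1
      · exact hM ⟨t, ⟨ht, h1⟩, rfl⟩
      · exact (hra (mem_Ici.2 le_rfl) (mem_Ici.2 h1) h1).trans (hM ⟨T, ⟨hT0, le_rfl⟩, rfl⟩)

/-- threshold -/
def dlt (a p n : ℝ) : ℝ := ((1 + p) * tanh 1 * (a * (1 + p) / 2) ^ n) * (π / 8)

theorem tanh_one_pos : 0 < tanh 1 := by
  rw [Real.tanh_eq_sinh_div_cosh]
  have := Real.sinh_pos_iff.2 one_pos
  have := Real.cosh_pos 1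
  positivity

theorem tanh_ge {t : ℝ} (ht : 1 ≤ t) : tanh 1 ≤ tanh t := by
  rw [Real.tanh_eq_sinh_div_cosh, Real.tanh_eq_sinh_div_cosh,
    div_le_div_iff₀ (Real.cosh_pos _) (Real.cosh_pos _)]
  have h1 := Real.sinh_sub t 1
  have h2 : 0 ≤ sinh (t - 1) := Real.sinh_nonneg_iff.2 (by linarith)
  linarith

theorem PS.lemX {a p n : ℝ} (ha : 1 / 2 ≤ a) (hp : 0 < p) (hnp : n * p = 1) {θ L : ℝ → ℝ}
    (h : PS a p θ L) {T T' : ℝ} (hT : 1 ≤ T) (hTT : T ≤ T') (J : ℤ) (hθ : J * π ≤ θ T)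
    (hF : FF a p n θ L T < dlt a p n) (hG : ∀ t ∈ Icc T T', 0 ≤ GG a p θ L t) :
    J * π - 3 * π / 4 < θ T' := by
  by_contra hcon
  push Not at hcon
  have hπ := Real.pi_pos
  have hn : 0 < n := by
    by_contra hcon
    have := mul_nonpos_of_nonpos_of_nonneg (not_lt.1 hcon) hp.le
    linarith
  have hanti := h.θ_anti ha hp (convex_Icc T T') hG
  obtain ⟨t1, ht1, e1⟩ := intermediate_value_Icc' hTT h.contθ.continuousOn
    (show J * π - 5 * π / 8 ∈ Icc (θ T') (θ T) from ⟨by linarith, by linarith⟩)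
  obtain ⟨t2, ht2, e2⟩ := intermediate_value_Icc' ht1.2 h.contθ.continuousOn
    (show J * π - 3 * π / 4 ∈ Icc (θ T') (θ t1) from ⟨by linarith, by linarith⟩)
  have hFa : AntitoneOn (FF a p n θ L) (Icc T T') := by
    refine antitoneOn_of_deriv_nonpos (convex_Icc T T')
      (fun t _ => (h.derivF hnp t).continuousAt.continuousWithinAt)
      (fun t _ => (h.derivF hnp t).differentiableAt.differentiableWithinAt) fun t ht => ?_
    have ht' := interior_subset ht
    rw [(h.derivF hnp t).deriv]
    have h1 := PS.θ'_nonpos ha hp (hG t ht')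
    have h2 := tanh_one_pos.trans_le (tanh_ge (hT.trans ht'.1))
    exact mul_nonpos_of_nonneg_of_nonpos (by positivity) h1
  set κ := (1 + p) * tanh 1 * (a * (1 + p) / 2) ^ n with hκ
  have hd : ∀ t, HasDerivAt (fun t => FF a p n θ L t - κ * θ t) _ t :=
    fun t => (h.derivF hnp t).sub ((h t).1.const_mul κ)
  have hda : AntitoneOn (fun t => FF a p n θ L t - κ * θ t) (Icc t1 t2) := by
    refine antitoneOn_of_deriv_nonpos (convex_Icc t1 t2)
      (fun t _ => (hd t).continuousAt.continuousWithinAt)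
      (fun t _ => (hd t).differentiableAt.differentiableWithinAt) fun t ht => ?_
    have ht' := interior_subset ht
    have hm : t ∈ Icc T T' := ⟨ht1.1.trans ht'.1, ht'.2.trans ht2.2⟩
    rw [(hd t).deriv]
    have h1 := PS.θ'_nonpos ha hp (hG t hm)
    have h2 := tanh_ge (hT.trans hm.1)
    have b1 := hanti ht1 hm ht'.1
    have b2 := hanti hm ⟨ht1.1.trans ht2.1, ht2.2⟩ ht'.2
    rw [e1] at b1
    rw [e2] at b2
    have hsn : 1 / 2 ≤ sin (2 * θ t) := by
      have : sin (2 * θ t) = sin (2 * J * π - 2 * θ t - π) := by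
        rw [Real.sin_sub_pi, show 2 * J * π - 2 * θ t = -(2 * (θ t + (-J : ℤ) * π)) by
          push_cast; ring, Real.sin_neg, sin_two_int]
        ring
      rw [this, ← Real.sin_pi_div_six]
      apply Real.sin_le_sin_of_le_of_le_pi_div_two <;> linarith
    have hGt := hG t hm
    unfold GG at hGt
    have hb : 0 < a * (1 + p) := by positivity
    have h3 : a * (1 + p) / 2 ≤ exp (L t) := by nlinarith
    have h4 : (a * (1 + p) / 2) ^ n ≤ exp (n * L t) := by
      rw [mul_comm n, Real.exp_mul]
      exact Real.rpow_le_rpow (by positivity) h3 hn.le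
    have h5 : κ ≤ (1 + p) * tanh t * exp (n * L t) := by
      rw [hκ]
      have := tanh_one_pos
      have := this.trans_le h2
      gcongr
    rw [← sub_mul]
    exact mul_nonpos_of_nonneg_of_nonpos (by linarith) h1
  have f1 := hFa (left_mem_Icc.2 hTT) ht1 ht1.1
  have f2 := hda (left_mem_Icc.2 ht2.1) (right_mem_Icc.2 ht2.1) ht2.1
  simp only [e1, e2] at f2
  have f3 : 0 ≤ FF a p n θ L t2 := mul_nonneg (exp_pos _).le (hG t2 ⟨ht1.1.trans ht2.1, ht2.2⟩)
  unfold dlt at hF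
  rw [← hκ] at hF
  nlinarith

theorem PS.lemX' {a p n : ℝ} (ha : 1 / 2 ≤ a) (hp : 0 < p) (hnp : n * p = 1) {θ L : ℝ → ℝ}
    (h : PS a p θ L) {T : ℝ} (hT : 1 ≤ T) (J : ℤ) (hθ : J * π ≤ θ T)
    (hF : FF a p n θ L T < dlt a p n) {t : ℝ} (ht : T ≤ t) : J * π - π < θ t := by
  by_contra hcon
  push Not at hcon
  have hπ := Real.pi_pos
  obtain ⟨t1, ht1, e1⟩ := intermediate_value_Icc' ht h.contθ.continuousOn
    (show J * π - 3 * π / 4 ∈ Icc (θ t) (θ T) from ⟨by linarith, by linarith⟩)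
  obtain ⟨t2, ht2, e2⟩ := intermediate_value_Icc' ht1.2 h.contθ.continuousOn
    (show J * π - π ∈ Icc (θ t) (θ t1) from ⟨by linarith, by linarith⟩)
  have : ∃ s ∈ Icc T t1, GG a p θ L s < 0 := by
    by_contra hno
    push Not at hno
    have := h.lemX ha hp hnp hT ht1.1 J hθ hF hno
    linarith
  obtain ⟨s, hs, hs0⟩ := this
  have h2 := h.G_neg' hp (by linarith [hs.1]) (hs.2.trans ht2.1) hs0
  unfold GG at h2
  have e := sin_two_int (J - 1) 0
  rw [zero_add, mul_zero, Real.sin_zero] at e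
  rw [e2, show J * π - π = ((J - 1 : ℤ) : ℝ) * π by push_cast; ring, e] at h2
  have := exp_pos (L t2)
  linarith

theorem PS.L_bound {a p : ℝ} (ha : 1 / 2 ≤ a) (hp : 0 < p) {θ L : ℝ → ℝ}
    (h : PS a p θ L) (t : ℝ) : |L t - L 0| ≤ (2 * a * p + p) * |t| := by
  have := (convex_univ (𝕜 := ℝ) (E := ℝ)).norm_image_sub_le_of_norm_hasDerivWithin_le
    (f := L) (C := 2 * a * p + p) (x := 0) (y := t)
    (fun x _ => (h x).2.hasDerivWithinAt) (fun x _ => ?_) (mem_univ _) (mem_univ _)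
  · simpa [Real.norm_eq_abs] using this
  · rw [Real.norm_eq_abs, abs_le]
    have h1 := Real.neg_one_le_cos (2 * θ x)
    have h2 := Real.cos_le_one (2 * θ x)
    have h3 := Real.neg_one_lt_tanh x
    have h4 := Real.tanh_lt_one x
    have : 0 < a * p := by positivity
    constructor <;> nlinarith

theorem PS.large {a p : ℝ} (ha : 1 / 2 ≤ a) (hp : 0 < p) {θ L : ℝ → ℝ}
    (h : PS a p θ L) : θ 1 ≤ θ 0 + a - exp (L 0 - (2 * a * p + p)) := by
  have hd : ∀ t, HasDerivAt (fun t => θ t - (a - exp (L 0 - (2 * a * p + p))) * t)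
      (a * sin (2 * θ t) - exp (L t) - (a - exp (L 0 - (2 * a * p + p))) * 1) t :=
    fun t => (h t).1.sub ((hasDerivAt_id t).const_mul _)
  have hda : AntitoneOn (fun t => θ t - (a - exp (L 0 - (2 * a * p + p))) * t) (Icc 0 1) := by
    refine antitoneOn_of_deriv_nonpos (convex_Icc 0 1)
      (fun t _ => (hd t).continuousAt.continuousWithinAt)
      (fun t _ => (hd t).differentiableAt.differentiableWithinAt) fun t ht => ?_
    have ht' := interior_subset ht
    rw [(hd t).deriv]
    have h1 := (abs_le.1 (h.L_bound ha hp t)).1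
    rw [abs_of_nonneg ht'.1] at h1
    have h2 : (2 * a * p + p) * t ≤ (2 * a * p + p) * 1 := by
      have := ht'.2
      gcongr
    have h3 : exp (L 0 - (2 * a * p + p)) ≤ exp (L t) := exp_le_exp.2 (by linarith)
    have h4 := Real.sin_le_one (2 * θ t)
    nlinarith
  have := hda (left_mem_Icc.2 zero_le_one) (right_mem_Icc.2 zero_le_one) zero_le_one
  simp only at this
  linarith


/-- truncated vector field -/
def fld (a p B t : ℝ) (x : ℝ × ℝ) : ℝ × ℝ :=
  (a * sin (2 * x.1) - exp (min x.2 B), -(2 * a * p) * cos (2 * x.1) - p * tanh t)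

theorem exp_min_lip (B x y : ℝ) : |exp (min x B) - exp (min y B)| ≤ exp B * |x - y| := by
  have h1 := (convex_Iic B).norm_image_sub_le_of_norm_hasDerivWithin_le
    (f := exp) (f' := exp) (C := exp B) (x := min y B) (y := min x B)
    (fun z _ => (Real.hasDerivAt_exp z).hasDerivWithinAt)
    (fun z hz => by
      rw [Real.norm_eq_abs, abs_of_pos (exp_pos _)]
      exact exp_le_exp.2 hz) (mem_Iic.2 (min_le_right _ _)) (mem_Iic.2 (min_le_right _ _))
  rw [Real.norm_eq_abs, Real.norm_eq_abs] at h1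
  refine h1.trans (mul_le_mul_of_nonneg_left ?_ (exp_pos _).le)
  have := abs_min_sub_min_le_max x B y B
  simpa using this

theorem sin2_lip (x y : ℝ) : |sin (2 * x) - sin (2 * y)| ≤ 2 * |x - y| := by
  have h1 := (convex_univ (𝕜 := ℝ) (E := ℝ)).norm_image_sub_le_of_norm_hasDerivWithin_le
    (f := sin) (f' := cos) (C := 1) (x := 2 * y) (y := 2 * x)
    (fun z _ => (Real.hasDerivAt_sin z).hasDerivWithinAt)
    (fun z hz => Real.abs_cos_le_one z) (mem_univ _) (mem_univ _)
  rw [Real.norm_eq_abs, Real.norm_eq_abs, ← mul_sub, abs_mul, abs_two, one_mul] at h1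
  exact h1

theorem cos2_lip (x y : ℝ) : |cos (2 * x) - cos (2 * y)| ≤ 2 * |x - y| := by
  have h1 := (convex_univ (𝕜 := ℝ) (E := ℝ)).norm_image_sub_le_of_norm_hasDerivWithin_le
    (f := cos) (f' := fun z => - sin z) (C := 1) (x := 2 * y) (y := 2 * x)
    (fun z _ => (Real.hasDerivAt_cos z).hasDerivWithinAt)
    (fun z hz => by rw [norm_neg]; exact Real.abs_sin_le_one z) (mem_univ _) (mem_univ _)
  rw [Real.norm_eq_abs, Real.norm_eq_abs, ← mul_sub, abs_mul, abs_two, one_mul] at h1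
  exact h1

theorem fld_lip {a p : ℝ} (ha : 1 / 2 ≤ a) (hp : 0 < p) (B t : ℝ) :
    LipschitzWith (Real.toNNReal (2 * a + exp B + 4 * a * p)) (fld a p B t) := by
  refine LipschitzWith.of_dist_le_mul fun x y => ?_
  have hK : 0 ≤ 2 * a + exp B + 4 * a * p := by positivity
  rw [Real.coe_toNNReal _ hK, Prod.dist_eq, Prod.dist_eq]
  set d := max (dist x.1 y.1) (dist x.2 y.2) with hd
  have d1 : |x.1 - y.1| ≤ d := le_max_left _ _
  have d2 : |x.2 - y.2| ≤ d := le_max_right _ _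
  have d0 : 0 ≤ d := (abs_nonneg _).trans d1
  have hap : 0 < a * p := by positivity
  have e0 := exp_pos B
  refine max_le ?_ ?_
  · simp only [fld, Real.dist_eq]
    have e1 := sin2_lip x.1 y.1
    have e2 := exp_min_lip B x.2 y.2
    have : a * sin (2 * x.1) - exp (min x.2 B) - (a * sin (2 * y.1) - exp (min y.2 B))
      = a * (sin (2 * x.1) - sin (2 * y.1)) - (exp (min x.2 B) - exp (min y.2 B)) := by ring
    rw [this]
    refine (abs_sub _ _).trans ?_
    rw [abs_mul, abs_of_pos (by linarith : 0 < a)]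
    have e3 : a * |sin (2 * x.1) - sin (2 * y.1)| ≤ a * (2 * d) := by gcongr; linarith
    have e4 : exp B * |x.2 - y.2| ≤ exp B * d := by gcongr
    nlinarith
  · simp only [fld, Real.dist_eq]
    have e1 := cos2_lip x.1 y.1
    have : -(2 * a * p) * cos (2 * x.1) - p * tanh t - (-(2 * a * p) * cos (2 * y.1) - p * tanh t)
      = -(2 * a * p) * (cos (2 * x.1) - cos (2 * y.1)) := by ring
    rw [this, abs_mul, abs_neg, abs_of_pos (by positivity : 0 < 2 * a * p)]
    have e3 : 2 * a * p * |cos (2 * x.1) - cos (2 * y.1)| ≤ 2 * a * p * (2 * d) := by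
      gcongr; linarith
    nlinarith

theorem continuous_tanh' : Continuous Real.tanh := by
  have : Real.tanh = fun x => sinh x / cosh x := funext Real.tanh_eq_sinh_div_cosh
  rw [this]
  exact Real.continuous_sinh.div Real.continuous_cosh fun x => (Real.cosh_pos x).ne'

theorem fld_bound {a p : ℝ} (ha : 1 / 2 ≤ a) (hp : 0 < p) (B t : ℝ) (x : ℝ × ℝ) :
    ‖fld a p B t x‖ ≤ a + exp B + 2 * a * p + p := by
  have hap : 0 < a * p := by positivity
  have e0 := exp_pos B
  have s1 := Real.neg_one_le_sin (2 * x.1)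
  have s2 := Real.sin_le_one (2 * x.1)
  have c1 := Real.neg_one_le_cos (2 * x.1)
  have c2 := Real.cos_le_one (2 * x.1)
  have t1 := Real.neg_one_lt_tanh t
  have t2 := Real.tanh_lt_one t
  have e1 : exp (min x.2 B) ≤ exp B := exp_le_exp.2 (min_le_right _ _)
  have e2 := exp_pos (min x.2 B)
  rw [Prod.norm_def]
  refine max_le ?_ ?_
  · simp only [fld, Real.norm_eq_abs, abs_le]
    constructor <;> nlinarith
  · simp only [fld, Real.norm_eq_abs, abs_le]
    constructor <;> nlinarith

theorem exists_N {a p : ℝ} (ha : 1 / 2 ≤ a) (hp : 0 < p) (x0 : ℝ × ℝ) (N : ℝ) (hN : 0 < N) :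
    ∃ x : ℝ → ℝ × ℝ, x 0 = x0 ∧ (∀ t ∈ Ioo (-N) N, 
      HasDerivAt x (a * sin (2 * (x t).1) - exp ((x t).2),
        -(2 * a * p) * cos (2 * (x t).1) - p * tanh t) t) ∧
      ∀ t ∈ Ioo (-N) N, (x t).2 ≤ x0.2 + (2 * a * p + p) * N := by
  have hap : 0 < a * p := by positivity
  set B := x0.2 + (2 * a * p + p) * N with hB
  set C := a + exp B + 2 * a * p + p with hC
  have hC0 : 0 ≤ C := by positivity
  have hpl : IsPicardLindelof (fld a p B) (tmin := -N) (tmax := N)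
      (⟨0, by constructor <;> linarith⟩ : Icc (-N) N) x0 (Real.toNNReal (C * N)) 0
      (Real.toNNReal C) (Real.toNNReal (2 * a + exp B + 4 * a * p)) := by
    refine ⟨fun t _ => (fld_lip ha hp B t).lipschitzOnWith, fun x _ => ?_, fun t _ x _ => ?_, ?_⟩
    · have := continuous_tanh'
      unfold fld
      fun_prop
    · rw [Real.coe_toNNReal _ hC0]
      exact fld_bound ha hp B t x
    · rw [Real.coe_toNNReal _ hC0, Real.coe_toNNReal _ (by positivity)]
      simp
  obtain ⟨x, hx0, hx⟩ := hpl.exists_eq_forall_mem_Icc_hasDerivWithinAt₀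
  simp only at hx0
  have hd : ∀ t ∈ Ioo (-N) N, HasDerivAt x (fld a p B t (x t)) t := fun t ht =>
    (hx t (Ioo_subset_Icc_self ht)).hasDerivAt (Icc_mem_nhds ht.1 ht.2)
  have hd2 : ∀ t ∈ Ioo (-N) N, HasDerivAt (fun t => (x t).2)
      (-(2 * a * p) * cos (2 * (x t).1) - p * tanh t) t := fun t ht => by
    have h := hd t ht
    unfold fld at h
    exact (hasFDerivAt_snd.comp_hasDerivAt t h : _)
  have hle : ∀ t ∈ Ioo (-N) N, (x t).2 ≤ B := by
    intro t ht
    have := (convex_Ioo (-N) N).norm_image_sub_le_of_norm_hasDerivWithin_le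
      (f := fun t => (x t).2) (C := 2 * a * p + p) (x := 0) (y := t)
      (fun s hs => (hd2 s hs).hasDerivWithinAt) (fun s _ => ?_) (by constructor <;> linarith) ht
    · rw [hx0, Real.norm_eq_abs, Real.norm_eq_abs, sub_zero] at this
      have h1 := (abs_le.1 this).2
      have h2 : |t| ≤ N := (abs_lt.2 ht).le
      have : (2 * a * p + p) * |t| ≤ (2 * a * p + p) * N := by gcongr
      linarith
    · rw [Real.norm_eq_abs, abs_le]
      have h1 := Real.neg_one_le_cos (2 * (x s).1)
      have h2 := Real.cos_le_one (2 * (x s).1)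
      have h3 := Real.neg_one_lt_tanh s
      have h4 := Real.tanh_lt_one s
      constructor <;> nlinarith
  refine ⟨x, hx0, fun t ht => ?_, hle⟩
  have := hd t ht
  unfold fld at this
  rwa [min_eq_left (hle t ht)] at this

theorem exists_PS {a p : ℝ} (ha : 1 / 2 ≤ a) (hp : 0 < p) (θ0 L0 : ℝ) :
    ∃ θ L : ℝ → ℝ, PS a p θ L ∧ θ 0 = θ0 ∧ L 0 = L0 := by
  have hex := fun N : ℕ => exists_N ha hp (θ0, L0) ((N : ℝ) + 1) (by positivity)
  choose x hx0 hx hxB using hex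
  have huniq : ∀ N M : ℕ, N ≤ M → ∀ t ∈ Ioo (-((N : ℝ) + 1)) (N + 1), x N t = x M t := by
    intro N M hNM t ht
    have hNM' : (N : ℝ) ≤ M := by exact_mod_cast hNM
    set B := L0 + (2 * a * p + p) * ((M : ℝ) + 1) with hB
    have hap : 0 < a * p := by positivity
    refine ODE_solution_unique_of_mem_Ioo (v := fld a p B) (s := fun _ => univ) (t₀ := 0)
      (K := Real.toNNReal (2 * a + exp B + 4 * a * p))
      (fun s _ => (fld_lip ha hp B s).lipschitzOnWith) (by constructor <;> linarith [N.cast_nonneg (α := ℝ)])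
      (fun s hs => ⟨?_, mem_univ _⟩) (fun s hs => ⟨?_, mem_univ _⟩) ((hx0 N).trans (hx0 M).symm) ht
    · have := hx N s hs
      unfold fld
      rw [min_eq_left]
      · exact this
      · refine (hxB N s hs).trans ?_
        rw [hB]
        simp only
        gcongr
    · have hs' : s ∈ Ioo (-((M : ℝ) + 1)) (M + 1) :=
        ⟨by linarith [hs.1], by linarith [hs.2]⟩
      have := hx M s hs'
      unfold fld
      rw [min_eq_left]
      · exact this
      · exact hxB M s hs'
  set y : ℝ → ℝ × ℝ := fun t => x ⌈|t|⌉₊ t with hy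
  have hyN : ∀ (N : ℕ) t, t ∈ Ioo (-((N : ℝ) + 1)) (N + 1) → y t = x N t := by
    intro N t ht
    rcases le_total ⌈|t|⌉₊ N with h1 | h1
    · refine huniq _ _ h1 t ?_
      have := Nat.le_ceil |t|
      rw [mem_Ioo, ← abs_lt]
      linarith
    · exact (huniq _ _ h1 t ht).symm
  have hyd : ∀ t, HasDerivAt y (a * sin (2 * (y t).1) - exp ((y t).2),
        -(2 * a * p) * cos (2 * (y t).1) - p * tanh t) t := by
    intro t
    have hm : t ∈ Ioo (-((⌈|t|⌉₊ : ℝ) + 1)) (⌈|t|⌉₊ + 1) := by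
      have := Nat.le_ceil |t|
      rw [mem_Ioo, ← abs_lt]
      linarith
    have h1 := hx _ t hm
    refine HasDerivAt.congr_of_eventuallyEq (f := x ⌈|t|⌉₊) h1 ?_
    filter_upwards [Ioo_mem_nhds hm.1 hm.2] with s hs
    exact hyN _ s hs
  have hy0 : y 0 = (θ0, L0) := hx0 _
  refine ⟨fun t => (y t).1, fun t => (y t).2, fun t => ⟨?_, ?_⟩, ?_, ?_⟩
  · exact (hasFDerivAt_fst.comp_hasDerivAt t (hyd t) : _)
  · exact (hasFDerivAt_snd.comp_hasDerivAt t (hyd t) : _)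
  · simp [hy0]
  · simp [hy0]

theorem PS.dist_le {a p : ℝ} (ha : 1 / 2 ≤ a) (hp : 0 < p) {θ L θ' L' : ℝ → ℝ}
    (h : PS a p θ L) (h' : PS a p θ' L') {t B : ℝ} (ht : 0 ≤ t)
    (hB : L 0 + (2 * a * p + p) * t ≤ B) (hB' : L' 0 + (2 * a * p + p) * t ≤ B) :
    dist (θ t, L t) (θ' t, L' t) ≤ dist (θ 0, L 0) (θ' 0, L' 0) *
      exp (Real.toNNReal (2 * a + exp B + 4 * a * p) * (t - 0)) := by
  have hap : 0 < a * p := by positivity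
  have aux : ∀ {θ L : ℝ → ℝ}, PS a p θ L → L 0 + (2 * a * p + p) * t ≤ B → ∀ s ∈ Ico 0 t,
      HasDerivWithinAt (fun s => (θ s, L s)) (fld a p B s (θ s, L s)) (Ici s) s := by
    intro θ L h hB s hs
    have h1 := (abs_le.1 (h.L_bound ha hp s)).2
    rw [abs_of_nonneg hs.1] at h1
    have h2 : (2 * a * p + p) * s ≤ (2 * a * p + p) * t := by
      have := hs.2.le
      gcongr
    unfold fld
    rw [min_eq_left (by simp only; linarith)]
    exact ((h s).1.prodMk (h s).2).hasDerivWithinAt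
  exact dist_le_of_trajectories_ODE (v := fld a p B) (f := fun s => (θ s, L s))
    (g := fun s => (θ' s, L' s)) (a := 0) (b := t) (fun s => fld_lip ha hp B s)
    (h.contθ.prodMk h.contL).continuousOn (aux h hB)
    (h'.contθ.prodMk h'.contL).continuousOn (aux h' hB') le_rfl t (right_mem_Icc.2 ht)

theorem PS.unique {a p : ℝ} (ha : 1 / 2 ≤ a) (hp : 0 < p) {θ L θ' L' : ℝ → ℝ}
    (h : PS a p θ L) (h' : PS a p θ' L') (e1 : θ 0 = θ' 0) (e2 : L 0 = L' 0)
    {t : ℝ} (ht : 0 ≤ t) : θ t = θ' t ∧ L t = L' t := by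
  have := h.dist_le ha hp h' ht le_rfl (by rw [e2])
  rw [e1, e2, dist_self, zero_mul] at this
  have := dist_le_zero.1 this
  exact ⟨congrArg Prod.fst this, congrArg Prod.snd this⟩

theorem PS.reflect {a p : ℝ} {θ L : ℝ → ℝ} (h : PS a p θ L) :
    PS a p (fun t => π / 2 - θ (-t)) (fun t => L (-t)) := by
  intro t
  have h1 := ((h (-t)).1.comp t (hasDerivAt_neg t))
  have h2 := ((h (-t)).2.comp t (hasDerivAt_neg t))
  constructor
  · refine (h1.const_sub (π / 2)).congr_deriv ?_
    rw [show 2 * (π / 2 - θ (-t)) = π - 2 * θ (-t) by ring, Real.sin_pi_sub]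
    ring
  · refine h2.congr_deriv ?_
    rw [show 2 * (π / 2 - θ (-t)) = π - 2 * θ (-t) by ring, Real.cos_pi_sub, Real.tanh_neg]
    ring

theorem PS.symm {a p : ℝ} (ha : 1 / 2 ≤ a) (hp : 0 < p) {θ L : ℝ → ℝ} (h : PS a p θ L)
    (h0 : θ 0 = π / 4) (t : ℝ) : θ (-t) = π / 2 - θ t ∧ L (-t) = L t := by
  have e1 : θ 0 = (fun t => π / 2 - θ (-t)) 0 := by simp only [neg_zero]; rw [h0]; ring
  rcases le_total 0 t with ht | ht
  · have := h.unique ha hp h.reflect e1 (by simp) ht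
    constructor
    · linarith
    · linarith
  · have := h.unique ha hp h.reflect e1 (by simp) (neg_nonneg.2 ht)
    simp only [neg_neg] at this
    constructor
    · linarith
    · linarith

/-- canonical solution -/
theorem exists_flow {a p : ℝ} (ha : 1 / 2 ≤ a) (hp : 0 < p) :
    ∃ Θ Λ : ℝ → ℝ → ℝ, (∀ l, PS a p (Θ l) (Λ l) ∧ Θ l 0 = π / 4 ∧ Λ l 0 = l) ∧
      ∀ t, 0 ≤ t → Continuous (fun l => Θ l t) ∧ Continuous (fun l => Λ l t) := by
  have hex := fun l => exists_PS ha hp (π / 4) l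
  choose Θ Λ hP h0 h1 using hex
  refine ⟨Θ, Λ, fun l => ⟨hP l, h0 l, h1 l⟩, fun t ht => ?_⟩
  have hap : 0 < a * p := by positivity
  have hc : Continuous (fun l => (Θ l t, Λ l t)) := by
    rw [continuous_iff_continuousAt]
    intro l0
    set B := l0 + 1 + (2 * a * p + p) * t with hB
    set C := exp (Real.toNNReal (2 * a + exp B + 4 * a * p) * (t - 0)) with hC
    have hlim : Tendsto (fun l => dist l l0 * C) (𝓝 l0) (𝓝 0) := by
      have : Tendsto (fun l => dist l l0 * C) (𝓝 l0) (𝓝 (dist l0 l0 * C)) :=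
        ((continuous_id.dist continuous_const).mul continuous_const).tendsto l0
      simpa using this
    refine tendsto_iff_dist_tendsto_zero.2 ?_
    refine squeeze_zero' (Eventually.of_forall fun _ => dist_nonneg) ?_ hlim
    filter_upwards [Iio_mem_nhds (show l0 < l0 + 1 by linarith)] with l hl
    have hl' : l < l0 + 1 := hl
    have := (hP l).dist_le ha hp (hP l0) (t := t) (B := B) ht
      (by rw [h1]; linarith) (by rw [h1]; linarith)
    have e : dist (π / 4, l) (π / 4, l0) = dist l l0 := by
      rw [Prod.dist_eq]; simp
    rw [h0, h0, h1, h1, e] at this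
    exact this
  exact ⟨continuous_fst.comp hc, continuous_snd.comp hc⟩


/-- modulus -/
def rr (n : ℝ) (L : ℝ → ℝ) (t : ℝ) : ℝ := exp ((log (cosh t) + n * L t) / 2)

theorem rr_pos (n : ℝ) (L : ℝ → ℝ) (t : ℝ) : 0 < rr n L t := exp_pos _

theorem rr_sq (n : ℝ) (L : ℝ → ℝ) (t : ℝ) : rr n L t ^ 2 = cosh t * exp (n * L t) := by
  unfold rr
  rw [← Real.exp_nat_mul, show ((2 : ℕ) : ℝ) * ((log (cosh t) + n * L t) / 2)
    = log (cosh t) + n * L t by push_cast; ring, Real.exp_add, Real.exp_log (Real.cosh_pos t)]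

theorem hasDerivAt_log_cosh (t : ℝ) : HasDerivAt (fun t => log (cosh t)) (tanh t) t := by
  rw [Real.tanh_eq_sinh_div_cosh]
  exact (Real.hasDerivAt_cosh t).log (Real.cosh_pos t).ne'

theorem PS.rr_deriv {a p n : ℝ} (hnp : n * p = 1) {θ L : ℝ → ℝ} (h : PS a p θ L) (t : ℝ) :
    HasDerivAt (rr n L) (rr n L t * (- (a * cos (2 * θ t)))) t := by
  have := (((hasDerivAt_log_cosh t).add ((h t).2.const_mul n)).div_const 2).exp
  refine this.congr_deriv ?_
  unfold rr
  have e : n * (-(2 * a * p) * cos (2 * θ t) - p * tanh t) = - 2 * a * cos (2 * θ t) - tanh t := by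
    linear_combination (-2 * a * cos (2 * θ t) - tanh t) * hnp
  rw [e]
  simp only [Pi.add_apply]
  ring

/-- identity for the coupling weight -/
theorem weight_eq {m : ℕ} (hm : 3 ≤ m) (t l : ℝ) :
    Real.cosh t ^ (-(1 : ℝ) / ((m : ℝ) - 1))
        * (cosh t * exp (((m : ℝ) - 1) * l)) ^ ((1 : ℝ) / ((m : ℝ) - 1)) = exp l := by
  have hm' : (3 : ℝ) ≤ m := by exact_mod_cast hm
  have h1 : (m : ℝ) - 1 ≠ 0 := by linarith
  have hc := Real.cosh_pos t
  rw [Real.mul_rpow hc.le (exp_pos _).le, ← mul_assoc, ← Real.rpow_add hc, ← Real.exp_mul]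
  rw [show -(1 : ℝ) / ((m : ℝ) - 1) + 1 / ((m : ℝ) - 1) = 0 by ring, Real.rpow_zero, one_mul]
  congr 1
  field_simp

theorem H2_eq {m : ℕ} (hm : 3 ≤ m) {θ L u v : ℝ → ℝ} {t : ℝ}
    (hu : u t = rr ((m : ℝ) - 1) L t * cos (θ t)) (hv : v t = rr ((m : ℝ) - 1) L t * sin (θ t)) :
    H2 m t (u t) (v t) = (((m : ℝ) - 1) / (2 * m)) *
      (cosh t * FF (((m : ℝ) - 2) / 2) (1 / ((m : ℝ) - 1)) ((m : ℝ) - 1) θ L t) := by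
  have hm' : (3 : ℝ) ≤ m := by exact_mod_cast hm
  have h1 : (m : ℝ) - 1 ≠ 0 := by linarith
  have h0 : (m : ℝ) ≠ 0 := by linarith
  have hR : (u t) ^ 2 + (v t) ^ 2 = cosh t * exp (((m : ℝ) - 1) * L t) := by
    rw [← rr_sq, hu, hv]
    linear_combination (rr ((m : ℝ) - 1) L t) ^ 2 * Real.sin_sq_add_cos_sq (θ t)
  have hRpos : 0 < cosh t * exp (((m : ℝ) - 1) * L t) := mul_pos (Real.cosh_pos t) (exp_pos _)
  have huv : u t * v t = cosh t * exp (((m : ℝ) - 1) * L t) * sin (2 * θ t) / 2 := by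
    rw [← rr_sq, hu, hv, Real.sin_two_mul]
    ring
  have hw := weight_eq hm t (L t)
  unfold H2
  rw [hR, show (m : ℝ) / ((m : ℝ) - 1) = 1 / ((m : ℝ) - 1) + 1 by field_simp; ring,
    Real.rpow_add_one hRpos.ne', mul_assoc (-(((m : ℝ) - 2) / 2)), huv]
  unfold FF GG
  rw [show ∀ x y z w : ℝ, x * y * (z * w) = x * (y * z) * w by intros; ring, hw]
  field_simp
  ring

theorem toUV {m : ℕ} (hm : 3 ≤ m) {θ L : ℝ → ℝ}
    (h : PS (((m : ℝ) - 2) / 2) (1 / ((m : ℝ) - 1)) θ L) :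
    IsSolS2 m (fun t => rr ((m : ℝ) - 1) L t * cos (θ t))
      (fun t => rr ((m : ℝ) - 1) L t * sin (θ t)) := by
  have hm' : (3 : ℝ) ≤ m := by exact_mod_cast hm
  have h1 : (m : ℝ) - 1 ≠ 0 := by linarith
  have hnp : ((m : ℝ) - 1) * (1 / ((m : ℝ) - 1)) = 1 := by field_simp
  intro t
  have hR : (rr ((m : ℝ) - 1) L t * cos (θ t)) ^ 2 + (rr ((m : ℝ) - 1) L t * sin (θ t)) ^ 2
      = cosh t * exp (((m : ℝ) - 1) * L t) := by
    rw [← rr_sq]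
    linear_combination (rr ((m : ℝ) - 1) L t) ^ 2 * Real.sin_sq_add_cos_sq (θ t)
  have hr := h.rr_deriv hnp t
  simp only [hR, weight_eq hm]
  constructor
  · refine (hr.mul (h t).1.cos).congr_deriv ?_
    have : cos (2 * θ t) * cos (θ t) + sin (2 * θ t) * sin (θ t) = cos (θ t) := by
      rw [← Real.cos_sub]; congr 1; ring
    linear_combination - (rr ((m : ℝ) - 1) L t) * (((m : ℝ) - 2) / 2) * this
  · refine (hr.mul (h t).1.sin).congr_deriv ?_
    have : sin (2 * θ t) * cos (θ t) - cos (2 * θ t) * sin (θ t) = sin (θ t) := by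
      rw [← Real.sin_sub]; congr 1; ring
    linear_combination (rr ((m : ℝ) - 1) L t) * (((m : ℝ) - 2) / 2) * this

theorem R_pos {m : ℕ} (hm : 3 ≤ m) {u v : ℝ → ℝ} (h : IsSolS2 m u v) (h0 : 0 < u 0) (t : ℝ) :
    0 < (u t) ^ 2 + (v t) ^ 2 := by
  have hm' : (3 : ℝ) ≤ m := by exact_mod_cast hm
  set a := ((m : ℝ) - 2) / 2 with ha
  have ha0 : 0 < a := by rw [ha]; linarith
  have hR : ∀ t, HasDerivAt (fun t => (u t) ^ 2 + (v t) ^ 2) (2 * a * ((v t) ^ 2 - (u t) ^ 2)) t := by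
    intro t
    refine (((h t).1.pow 2).add ((h t).2.pow 2)).congr_deriv ?_
    push_cast
    rw [← ha]
    ring
  have hR0 : 0 < (u 0) ^ 2 + (v 0) ^ 2 := by positivity
  rcases le_total 0 t with ht | ht
  · have hd : ∀ t, HasDerivAt (fun t => ((u t) ^ 2 + (v t) ^ 2) * exp (2 * a * t))
        (4 * a * (v t) ^ 2 * exp (2 * a * t)) t := by
      intro t
      refine ((hR t).mul (((hasDerivAt_id t).const_mul (2 * a)).exp)).congr_deriv ?_
      simp only [id]
      ring
    have hmono : Monotone (fun t => ((u t) ^ 2 + (v t) ^ 2) * exp (2 * a * t)) :=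
      monotone_of_deriv_nonneg (fun t => (hd t).differentiableAt) fun t => by
        rw [(hd t).deriv]; positivity
    have := hmono ht
    simp only [mul_zero, Real.exp_zero, mul_one] at this
    exact pos_of_mul_pos_left (hR0.trans_le this) (exp_pos _).le
  · have hd : ∀ t, HasDerivAt (fun t => ((u t) ^ 2 + (v t) ^ 2) * exp (-(2 * a) * t))
        (-(4 * a * (u t) ^ 2 * exp (-(2 * a) * t))) t := by
      intro t
      refine ((hR t).mul (((hasDerivAt_id t).const_mul (-(2 * a))).exp)).congr_deriv ?_
      simp only [id]
      ring
    have hmono : Antitone (fun t => ((u t) ^ 2 + (v t) ^ 2) * exp (-(2 * a) * t)) :=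
      antitone_of_deriv_nonpos (fun t => (hd t).differentiableAt) fun t => by
        rw [(hd t).deriv]
        have : 0 ≤ 4 * a * (u t) ^ 2 * exp (-(2 * a) * t) := by positivity
        linarith
    have := hmono ht
    simp only [mul_zero, Real.exp_zero, mul_one] at this
    exact pos_of_mul_pos_left (hR0.trans_le this) (exp_pos _).le

theorem toPolar {m : ℕ} (hm : 3 ≤ m) {u v : ℝ → ℝ} {μ : ℝ} (hμ : 0 < μ) (h : IsSolS2 m u v)
    (hu0 : u 0 = μ) (hv0 : v 0 = μ) :
    ∃ θ L : ℝ → ℝ, PS (((m : ℝ) - 2) / 2) (1 / ((m : ℝ) - 1)) θ L ∧ θ 0 = π / 4 ∧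
      L 0 = (1 / ((m : ℝ) - 1)) * log (μ ^ 2 + μ ^ 2) ∧
      ∀ t, u t = rr ((m : ℝ) - 1) L t * cos (θ t) ∧ v t = rr ((m : ℝ) - 1) L t * sin (θ t) := by
  have hm' : (3 : ℝ) ≤ m := by exact_mod_cast hm
  have h1 : (m : ℝ) - 1 ≠ 0 := by linarith
  set a := ((m : ℝ) - 2) / 2 with ha
  have ha0 : 0 < a := by rw [ha]; linarith
  have hRpos := R_pos hm h (by rw [hu0]; exact hμ)
  set L : ℝ → ℝ := fun t => (1 / ((m : ℝ) - 1)) * (log ((u t) ^ 2 + (v t) ^ 2) - log (cosh t)) with hL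
  have hLe : ∀ t, Real.cosh t ^ (-(1 : ℝ) / ((m : ℝ) - 1))
        * ((u t) ^ 2 + (v t) ^ 2) ^ ((1 : ℝ) / ((m : ℝ) - 1)) = exp (L t) := by
    intro t
    rw [← weight_eq hm t (L t)]
    congr 2
    have e : ((m : ℝ) - 1) * L t = log ((u t) ^ 2 + (v t) ^ 2) - log (cosh t) := by
      rw [hL]; field_simp
    rw [e, Real.exp_sub, Real.exp_log (hRpos t), Real.exp_log (Real.cosh_pos t)]
    have := (Real.cosh_pos t).ne'
    field_simp
  have hu : ∀ t, HasDerivAt u (exp (L t) * v t - a * u t) t := fun t => by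
    rw [← hLe]; exact (h t).1
  have hv : ∀ t, HasDerivAt v (a * v t - exp (L t) * u t) t := fun t => by
    rw [← hLe]; exact (h t).2
  have hR : ∀ t, HasDerivAt (fun t => (u t) ^ 2 + (v t) ^ 2) (2 * a * ((v t) ^ 2 - (u t) ^ 2)) t := by
    intro t
    refine (((hu t).pow 2).add ((hv t).pow 2)).congr_deriv ?_
    push_cast
    ring
  have hlogR : ∀ t, HasDerivAt (fun t => log ((u t) ^ 2 + (v t) ^ 2))
      (2 * a * ((v t) ^ 2 - (u t) ^ 2) / ((u t) ^ 2 + (v t) ^ 2)) t := fun t =>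
    (hR t).log (hRpos t).ne'
  have hLd : ∀ t, HasDerivAt L ((1 / ((m : ℝ) - 1)) *
      (2 * a * ((v t) ^ 2 - (u t) ^ 2) / ((u t) ^ 2 + (v t) ^ 2) - tanh t)) t := fun t =>
    ((hlogR t).sub (hasDerivAt_log_cosh t)).const_mul _
  have huc : Continuous u := continuous_iff_continuousAt.2 fun t => (hu t).continuousAt
  have hvc : Continuous v := continuous_iff_continuousAt.2 fun t => (hv t).continuousAt
  have hLc : Continuous L := continuous_iff_continuousAt.2 fun t => (hLd t).continuousAt
  set g : ℝ → ℝ := fun t => 2 * a * u t * v t / ((u t) ^ 2 + (v t) ^ 2) - exp (L t) with hg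
  have hgc : Continuous g := by
    apply Continuous.sub
    · exact Continuous.div (by fun_prop) (by fun_prop) fun t => (hRpos t).ne'
    · fun_prop
  set θ : ℝ → ℝ := fun t => π / 4 + ∫ s in (0 : ℝ)..t, g s with hθ
  have hθd : ∀ t, HasDerivAt θ (g t) t := fun t =>
    (intervalIntegral.integral_hasDerivAt_right (hgc.intervalIntegrable _ _)
      (hgc.stronglyMeasurableAtFilter _ _) hgc.continuousAt).const_add _
  have hθ0 : θ 0 = π / 4 := by simp [hθ]
  set q : ℝ → ℝ := fun t => exp (-(log ((u t) ^ 2 + (v t) ^ 2) / 2)) with hq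
  have hqpos : ∀ t, 0 < q t := fun t => exp_pos _
  have hqd : ∀ t, HasDerivAt q (q t * (-(a * ((v t) ^ 2 - (u t) ^ 2) / ((u t) ^ 2 + (v t) ^ 2)))) t := by
    intro t
    refine (((hlogR t).div_const 2).neg.exp).congr_deriv ?_
    simp only [hq, Pi.neg_apply]
    ring
  have hq2 : ∀ t, q t ^ 2 * ((u t) ^ 2 + (v t) ^ 2) = 1 := by
    intro t
    have : q t ^ 2 = ((u t) ^ 2 + (v t) ^ 2)⁻¹ := by
      simp only [hq]
      rw [← Real.exp_nat_mul, show ((2 : ℕ) : ℝ) * (-(log ((u t) ^ 2 + (v t) ^ 2) / 2))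
        = -log ((u t) ^ 2 + (v t) ^ 2) by push_cast; ring, Real.exp_neg, Real.exp_log (hRpos t)]
    rw [this, inv_mul_cancel₀ (hRpos t).ne']
  have hqr : ∀ t, rr ((m : ℝ) - 1) L t * q t = 1 := by
    intro t
    unfold rr
    simp only [hq]
    rw [← Real.exp_add, Real.exp_eq_one_iff]
    simp only [hL]
    field_simp
    ring
  have hPd : ∀ t, HasDerivAt (fun t => q t * (u t * cos (θ t) + v t * sin (θ t))) 0 t := by
    intro t
    refine ((hqd t).mul (((hu t).mul (hθd t).cos).add ((hv t).mul (hθd t).sin))).congr_deriv ?_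
    simp only [Pi.add_apply, Pi.mul_apply, hg]
    have := (hRpos t).ne'
    field_simp
    ring
  have hQd : ∀ t, HasDerivAt (fun t => q t * (v t * cos (θ t) - u t * sin (θ t))) 0 t := by
    intro t
    refine ((hqd t).mul (((hv t).mul (hθd t).cos).sub ((hu t).mul (hθd t).sin))).congr_deriv ?_
    simp only [Pi.sub_apply, Pi.mul_apply, hg]
    have := (hRpos t).ne'
    field_simp
    ring
  have hQ : ∀ t, q t * (v t * cos (θ t) - u t * sin (θ t)) = 0 := by
    intro t
    have := is_const_of_deriv_eq_zero (fun t => (hQd t).differentiableAt)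
      (fun t => (hQd t).deriv) t 0
    rw [this, hu0, hv0, hθ0, Real.cos_pi_div_four, Real.sin_pi_div_four]
    ring
  have hP : ∀ t, q t * (u t * cos (θ t) + v t * sin (θ t)) = 1 := by
    intro t
    have e := is_const_of_deriv_eq_zero (fun t => (hPd t).differentiableAt)
      (fun t => (hPd t).deriv) t 0
    rw [e]
    have e1 : 0 < q 0 * (u 0 * cos (θ 0) + v 0 * sin (θ 0)) := by
      rw [hu0, hv0, hθ0, Real.cos_pi_div_four, Real.sin_pi_div_four]
      have := hqpos 0
      positivity
    have e2 : (q 0 * (u 0 * cos (θ 0) + v 0 * sin (θ 0))) ^ 2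
        + (q 0 * (v 0 * cos (θ 0) - u 0 * sin (θ 0))) ^ 2 = 1 := by
      linear_combination hq2 0 + q 0 ^ 2 * (u 0 ^ 2 + v 0 ^ 2) * Real.sin_sq_add_cos_sq (θ 0)
    rw [hQ 0] at e2
    nlinarith
  have huv : ∀ t, u t = rr ((m : ℝ) - 1) L t * cos (θ t) ∧
      v t = rr ((m : ℝ) - 1) L t * sin (θ t) := by
    intro t
    have e := Real.sin_sq_add_cos_sq (θ t)
    constructor
    · linear_combination (- u t) * hqr t + rr ((m : ℝ) - 1) L t * cos (θ t) * hP t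
        - rr ((m : ℝ) - 1) L t * sin (θ t) * hQ t - rr ((m : ℝ) - 1) L t * q t * u t * e
    · linear_combination (- v t) * hqr t + rr ((m : ℝ) - 1) L t * sin (θ t) * hP t
        + rr ((m : ℝ) - 1) L t * cos (θ t) * hQ t - rr ((m : ℝ) - 1) L t * q t * v t * e
  refine ⟨θ, L, fun t => ⟨?_, ?_⟩, hθ0, ?_, huv⟩
  · refine (hθd t).congr_deriv ?_
    simp only [hg]
    congr 1
    rw [div_eq_iff (hRpos t).ne', Real.sin_two_mul]
    obtain ⟨e1, e2⟩ := huv t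
    rw [e1, e2]
    linear_combination (-2 * a * sin (θ t) * cos (θ t) * rr ((m : ℝ) - 1) L t ^ 2)
      * Real.sin_sq_add_cos_sq (θ t)
  · refine (hLd t).congr_deriv ?_
    have e : 2 * a * ((v t) ^ 2 - (u t) ^ 2) / ((u t) ^ 2 + (v t) ^ 2) = - 2 * a * cos (2 * θ t) := by
      rw [div_eq_iff (hRpos t).ne', Real.cos_two_mul]
      obtain ⟨e1, e2⟩ := huv t
      rw [e1, e2]
      have hs := Real.sin_sq (θ t)
      linear_combination (2 * a * rr ((m : ℝ) - 1) L t ^ 2 *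
        (1 + 2 * cos (θ t) ^ 2 - 1)) * (Real.sin_sq_add_cos_sq (θ t))
    rw [e]
    ring
  · simp only [hL, hu0, hv0, Real.cosh_zero, Real.log_one, sub_zero]


theorem PS.barN {a p : ℝ} {θ L : ℝ → ℝ} (h : PS a p θ L) (k : ℕ)
    {s t : ℝ} (hst : s < t) (hs : θ s ≤ -(k : ℝ) * π) : θ t < -(k : ℝ) * π := by
  have := h.barrier (-(k : ℤ)) hst (by push_cast; exact hs)
  push_cast at this
  exact this

theorem PS.barN' {a p : ℝ} {θ L : ℝ → ℝ} (h : PS a p θ L) (k : ℕ)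
    {s t : ℝ} (hst : s < t) (hs : θ s ≤ (1 - (k : ℝ)) * π) : θ t < (1 - (k : ℝ)) * π := by
  have := h.barrier (1 - (k : ℤ)) hst (by push_cast; exact hs)
  push_cast at this
  exact this

theorem PS.lt_pi {a p : ℝ} {θ L : ℝ → ℝ} (h : PS a p θ L) (h0 : θ 0 = π / 4) {t : ℝ}
    (ht : 0 ≤ t) : θ t < π := by
  have hpi := Real.pi_pos
  rcases ht.eq_or_lt with rfl | ht
  · rw [h0]; linarith
  · have := h.barN' 0 ht (by rw [h0]; push_cast; linarith)
    push_cast at this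
    linarith

theorem sin_shift (x : ℝ) (i : ℕ) : sin (x + i * π) = (-1) ^ i * sin x := by
  rw [Real.sin_add_nat_mul_pi]

theorem neg_one_sq_pow (i : ℕ) : ((-1 : ℝ) ^ i) * (-1) ^ i = 1 := by
  rw [← mul_pow]; norm_num

theorem atLeast_iff {a p n : ℝ} {θ L v : ℝ → ℝ} (h : PS a p θ L) (h0 : θ 0 = π / 4)
    (hv : ∀ t, v t = rr n L t * sin (θ t)) (k : ℕ) :
    ChangesSignAtLeast v (Ioi 0) k ↔ ∃ t, 0 < t ∧ θ t < (1 - (k : ℝ)) * π := by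
  have hpi := Real.pi_pos
  constructor
  · rintro ⟨s, hs, hmono, hprod⟩
    refine ⟨s k, hs k le_rfl, ?_⟩
    have : ∀ i, i ≤ k → θ (s i) < (1 - (i : ℝ)) * π := by
      intro i
      induction i with
      | zero =>
        intro hi
        have := h.lt_pi h0 (le_of_lt (hs 0 hi))
        push_cast; linarith
      | succ i ih =>
        intro hi
        have ih := ih (by omega)
        have hlt := hmono i (i + 1) (by omega) hi
        have hp := hprod i hi
        by_contra hcon
        push Not at hcon
        push_cast at hcon
        have e2 : -(i : ℝ) * π ≤ θ (s (i + 1)) := by linarith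
        have e1 : -(i : ℝ) * π < θ (s i) := by
          by_contra hc
          push Not at hc
          have := h.barN i hlt hc
          linarith
        have e3 := h.barN' i hlt ih.le
        have f1 : 0 ≤ sin (θ (s i) + i * π) :=
          Real.sin_nonneg_of_nonneg_of_le_pi (by linarith) (by linarith)
        have f2 : 0 ≤ sin (θ (s (i + 1)) + i * π) :=
          Real.sin_nonneg_of_nonneg_of_le_pi (by linarith) (by linarith)
        have f3 := mul_nonneg f1 f2
        rw [sin_shift, sin_shift] at f3
        have f4 : 0 ≤ sin (θ (s i)) * sin (θ (s (i + 1))) := by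
          have := neg_one_sq_pow i
          calc (0 : ℝ) ≤ _ := f3
            _ = ((-1 : ℝ) ^ i * (-1) ^ i) * (sin (θ (s i)) * sin (θ (s (i + 1)))) := by ring
            _ = _ := by rw [this, one_mul]
        rw [hv, hv] at hp
        have : 0 ≤ (rr n L (s i) * rr n L (s (i + 1))) * (sin (θ (s i)) * sin (θ (s (i + 1)))) :=
          mul_nonneg (mul_pos (rr_pos _ _ _) (rr_pos _ _ _)).le f4
        linarith
    exact this k le_rfl
  · rintro ⟨T, hT, hθT⟩
    rcases Nat.eq_zero_or_pos k with rfl | hk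
    · refine ⟨fun i => 1 + i, fun i _ => ?_, fun i j hij _ => ?_, fun i hi => by omega⟩
      · show (0 : ℝ) < 1 + i
        positivity
      · have : (i : ℝ) < j := by exact_mod_cast hij
        show (1 : ℝ) + i < 1 + j
        linarith
    have hk1 : (1 : ℝ) ≤ k := by exact_mod_cast hk
    have hT0 : θ T < 0 := by nlinarith
    have hex : ∀ i : ℕ, ∃ x ∈ Icc (0 : ℝ) T, θ x = max (θ T) ((1 / 8 - (i : ℝ)) * π) := by
      intro i
      have := intermediate_value_Icc' hT.le (h.contθ.continuousOn (s := Icc 0 T))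
      have hi : (0 : ℝ) ≤ i := Nat.cast_nonneg i
      obtain ⟨x, hx, hxe⟩ := this (a := max (θ T) ((1 / 8 - (i : ℝ)) * π))
        ⟨le_max_left _ _, by rw [h0]; exact max_le (by linarith) (by nlinarith)⟩
      exact ⟨x, hx, hxe⟩
    choose s hs hse using hex
    have hpos : ∀ i, 0 < s i := by
      intro i
      rcases (hs i).1.eq_or_lt with e | e
      · exfalso
        have := hse i
        rw [← e, h0] at this
        have hi : (0 : ℝ) ≤ i := Nat.cast_nonneg i
        have : max (θ T) ((1 / 8 - (i : ℝ)) * π) < π / 4 := max_lt (by linarith) (by nlinarith)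
        linarith
      · exact e
    have hlo : ∀ i : ℕ, -(i : ℝ) * π < θ (s i) := by
      intro i
      rw [hse]
      refine lt_of_lt_of_le ?_ (le_max_right _ _)
      nlinarith
    have hhi : ∀ i : ℕ, i ≤ k → θ (s i) < (1 - (i : ℝ)) * π := by
      intro i hi
      have : (i : ℝ) ≤ k := by exact_mod_cast hi
      rw [hse]
      refine max_lt (by nlinarith) (by nlinarith)
    refine ⟨s, fun i _ => hpos i, ?_, ?_⟩
    · intro i j hij hj
      have : (i : ℝ) + 1 ≤ j := by exact_mod_cast hij
      have h1 := hlo i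
      have h2 := hhi j hj
      have h3 : θ (s j) ≤ -(i : ℝ) * π := by nlinarith
      by_contra hcon
      push Not at hcon
      rcases hcon.eq_or_lt with e | e
      · rw [e] at h3; linarith
      · have := h.barN i e h3
        linarith
    · intro i hi
      have g1 : 0 < sin (θ (s i) + i * π) := by
        have h1 := hlo i
        have h2 := hhi i (by omega)
        exact Real.sin_pos_of_pos_of_lt_pi (by linarith) (by linarith)
      have g2 : 0 < sin (θ (s (i + 1)) + (i + 1 : ℕ) * π) := by
        have h1 := hlo (i + 1)
        have h2 := hhi (i + 1) hi
        exact Real.sin_pos_of_pos_of_lt_pi (by linarith) (by linarith)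
      have g3 := mul_pos g1 g2
      rw [sin_shift, sin_shift] at g3
      have g4 : sin (θ (s i)) * sin (θ (s (i + 1))) < 0 := by
        have e := neg_one_sq_pow i
        have : (-1) ^ i * sin (θ (s i)) * ((-1) ^ (i + 1) * sin (θ (s (i + 1))))
          = - (((-1 : ℝ) ^ i * (-1) ^ i) * (sin (θ (s i)) * sin (θ (s (i + 1))))) := by ring
        rw [this, e] at g3
        linarith
      rw [hv, hv]
      have : (rr n L (s i) * rr n L (s (i + 1))) * (sin (θ (s i)) * sin (θ (s (i + 1)))) < 0 :=
        mul_neg_of_pos_of_neg (mul_pos (rr_pos _ _ _) (rr_pos _ _ _)) g4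
      linarith

theorem exactly_iff {a p n : ℝ} {θ L v : ℝ → ℝ} (h : PS a p θ L) (h0 : θ 0 = π / 4)
    (hv : ∀ t, v t = rr n L t * sin (θ t)) (k : ℕ) :
    ChangesSignExactly v (Ioi 0) k ↔ (∃ t, 0 < t ∧ θ t < (1 - (k : ℝ)) * π) ∧
      ∀ t, 0 ≤ t → -(k : ℝ) * π < θ t := by
  have hpi := Real.pi_pos
  unfold ChangesSignExactly
  rw [atLeast_iff h h0 hv, atLeast_iff h h0 hv]
  refine and_congr_right fun _ => ?_
  push_cast
  constructor
  · intro hn t ht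
    by_contra hcon
    push Not at hcon
    have := h.barN k (show t < t + 1 by linarith) hcon
    exact hn ⟨t + 1, by linarith, by linarith⟩
  · rintro hn ⟨t, ht, hlt⟩
    have := hn t ht.le
    linarith

theorem HH_even {a p : ℝ} (n : ℝ) (ha : 1 / 2 ≤ a) (hp : 0 < p) {θ L : ℝ → ℝ} (h : PS a p θ L)
    (h0 : θ 0 = π / 4) (t : ℝ) : cosh (-t) * FF a p n θ L (-t) = cosh t * FF a p n θ L t := by
  obtain ⟨e1, e2⟩ := h.symm ha hp h0 t
  unfold FF GG
  rw [e1, e2, Real.cosh_neg, show 2 * (π / 2 - θ t) = π - 2 * θ t by ring, Real.sin_pi_sub]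

theorem energy_iff {m : ℕ} (hm : 3 ≤ m) {θ L u v : ℝ → ℝ}
    (h : PS (((m : ℝ) - 2) / 2) (1 / ((m : ℝ) - 1)) θ L) (h0 : θ 0 = π / 4)
    (huv : ∀ t, u t = rr ((m : ℝ) - 1) L t * cos (θ t) ∧ v t = rr ((m : ℝ) - 1) L t * sin (θ t)) :
    EnergyNegLimit m u v ↔
      ∃ t, 0 < t ∧ GG (((m : ℝ) - 2) / 2) (1 / ((m : ℝ) - 1)) θ L t < 0 := by
  have hm' : (3 : ℝ) ≤ m := by exact_mod_cast hm
  have ha : 1 / 2 ≤ ((m : ℝ) - 2) / 2 := by linarith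
  have hp : 0 < 1 / ((m : ℝ) - 1) := by apply one_div_pos.2; linarith
  have hnp : ((m : ℝ) - 1) * (1 / ((m : ℝ) - 1)) = 1 := by
    have h1 : (m : ℝ) - 1 ≠ 0 := by linarith
    field_simp
  have hc : 0 < ((m : ℝ) - 1) / (2 * m) := by apply div_pos <;> linarith
  set c := ((m : ℝ) - 1) / (2 * m) with hcdef
  set a := ((m : ℝ) - 2) / 2 with hadef
  set p := 1 / ((m : ℝ) - 1) with hpdef
  set n := (m : ℝ) - 1 with hndef
  have hH : ∀ t, H2 m t (u t) (v t) = c * (cosh t * FF a p n θ L t) := fun t =>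
    H2_eq hm (huv t).1 (huv t).2
  have hneg : ∀ t, H2 m t (u t) (v t) < 0 ↔ GG a p θ L t < 0 := by
    intro t
    rw [hH, ← FF_neg_iff (n := n)]
    exact ⟨fun hh => by by_contra hcon; push Not at hcon; have := mul_nonneg hc.le hcon; linarith,
      fun hh => mul_neg_of_pos_of_neg hc hh⟩
  constructor
  · intro hE
    have : ∀ᶠ t in atTop, H2 m t (u t) (v t) < 0 := by
      rcases hE with ⟨l, hl, h1, _⟩ | ⟨h1, _⟩
      · exact h1.eventually (gt_mem_nhds hl)
      · exact h1.eventually (eventually_lt_atBot 0)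
    obtain ⟨t, ht1, ht2⟩ := (this.and (eventually_gt_atTop 0)).exists
    exact ⟨t, ht2, (hneg t).1 ht1⟩
  · rintro ⟨T, hT, hGT⟩
    set f : ℝ → ℝ := fun t => H2 m t (u t) (v t) with hf
    have heven : ∀ t, f (-t) = f t := by
      intro t
      simp only [hf]
      rw [hH, hH, HH_even n ha hp h h0]
    have hbot : ∀ l, Tendsto f atTop l → Tendsto f atBot l := by
      intro l hl
      have := hl.comp tendsto_neg_atBot_atTop
      refine this.congr fun t => heven t
    have hanti : Antitone (fun t => f (max t 0)) := by
      intro x y hxy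
      simp only [hf]
      rw [hH, hH]
      refine mul_le_mul_of_nonneg_left ?_ hc.le
      exact (h.anti hp hnp).antitoneOn (le_max_right x 0) (le_max_right y 0) (max_le_max hxy le_rfl)
    have hev : (fun t => f (max t 0)) =ᶠ[atTop] f := by
      filter_upwards [eventually_ge_atTop 0] with t ht
      rw [max_eq_left ht]
    rcases tendsto_atTop_of_antitone hanti with h1 | ⟨l, hl⟩
    · right
      have := h1.congr' hev
      exact ⟨this, hbot _ this⟩
    · left
      have h2 := hl.congr' hev
      refine ⟨l, ?_, h2, hbot _ h2⟩
      have := hanti.le_of_tendsto hl T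
      rw [max_eq_left hT.le] at this
      exact this.trans_lt ((hneg T).2 hGT)

/-- a family of polar solutions parametrized by the initial height -/
structure Fam (a p n : ℝ) (θ L : ℝ → ℝ → ℝ) : Prop where
  ha : 1 / 2 ≤ a
  hp : 0 < p
  hnp : n * p = 1
  ps : ∀ μ, PS a p (θ μ) (L μ)
  h0 : ∀ μ, θ μ 0 = π / 4
  cθ : ∀ t, 0 ≤ t → ∀ μ, 0 < μ → ContinuousAt (fun μ => θ μ t) μ
  cL : ∀ t, 0 ≤ t → ∀ μ, 0 < μ → ContinuousAt (fun μ => L μ t) μ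
  large : ∀ K : ℕ, ∃ M, ∀ μ, M < μ → θ μ 1 < -(K : ℝ) * π

/-- exactly `k` sign changes in terms of the angle -/
def NN (k : ℕ) (f : ℝ → ℝ) : Prop :=
  (∃ t, 0 < t ∧ f t < (1 - (k : ℝ)) * π) ∧ ∀ t, 0 ≤ t → -(k : ℝ) * π < f t

/-- polar version of `A_k` -/
def SA (a p : ℝ) (θ L : ℝ → ℝ → ℝ) (k : ℕ) : Set ℝ :=
  {μ | 0 < μ ∧ NN k (θ μ) ∧ ∃ t, 0 < t ∧ GG a p (θ μ) (L μ) t < 0}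

/-- polar version of `I_k` -/
def SI (a p : ℝ) (θ L : ℝ → ℝ → ℝ) (k : ℕ) : Set ℝ :=
  {μ | 0 < μ ∧ NN k (θ μ) ∧ ∀ t, 0 ≤ t → 0 ≤ GG a p (θ μ) (L μ) t}

/-- angle bounded below by `-K π` -/
def LB (θ : ℝ → ℝ → ℝ) (K : ℕ) : Set ℝ :=
  {μ | 0 < μ ∧ ∀ t, 0 ≤ t → -(K : ℝ) * π < θ μ t}

theorem nat_lt_of_pi {i j : ℕ} {x : ℝ} (h1 : -(i : ℝ) * π < x) (h2 : x < (1 - (j : ℝ)) * π) :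
    j ≤ i := by
  have hpi := Real.pi_pos
  have h3 : (j : ℝ) * π < (i + 1) * π := by nlinarith
  have h4 : (j : ℝ) < i + 1 := lt_of_mul_lt_mul_right h3 hpi.le
  have h5 : j < i + 1 := by exact_mod_cast h4
  omega

theorem NN.le {k K : ℕ} {f : ℝ → ℝ} (h : NN k f) (hK : ∀ t, 0 ≤ t → -(K : ℝ) * π < f t) :
    k ≤ K := by
  obtain ⟨⟨t, ht, hlt⟩, _⟩ := h
  exact nat_lt_of_pi (hK t ht.le) hlt

theorem NN.eq {j k : ℕ} {f : ℝ → ℝ} (h : NN j f) (h' : NN k f) : j = k :=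
  le_antisymm (h.le h'.2) (h'.le h.2)

theorem dlt_pos {a p n : ℝ} (ha : 1 / 2 ≤ a) (hp : 0 < p) : 0 < dlt a p n := by
  unfold dlt
  have := tanh_one_pos
  have := Real.pi_pos
  have : 0 < a := by linarith
  have : 0 < (a * (1 + p) / 2) ^ n := Real.rpow_pos_of_pos (by positivity) _
  positivity

theorem GG_pos_of {a p : ℝ} {θ L : ℝ → ℝ} {t : ℝ} (j : ℤ) (h : θ t = j * π) :
    0 < GG a p θ L t := by
  unfold GG
  have := sin_two_int j 0
  rw [zero_add, mul_zero, Real.sin_zero] at this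
  rw [h, this, mul_zero, sub_zero]
  exact exp_pos _

theorem Fam.contG {a p n : ℝ} {θ L : ℝ → ℝ → ℝ} (F : Fam a p n θ L) {t : ℝ} (ht : 0 ≤ t) {μ : ℝ}
    (hμ : 0 < μ) : ContinuousAt (fun μ => GG a p (θ μ) (L μ) t) μ := by
  have h1 := F.cθ t ht μ hμ
  have h2 := F.cL t ht μ hμ
  unfold GG
  fun_prop

theorem Fam.contF {a p n : ℝ} {θ L : ℝ → ℝ → ℝ} (F : Fam a p n θ L) {t : ℝ} (ht : 0 ≤ t) {μ : ℝ}
    (hμ : 0 < μ) : ContinuousAt (fun μ => FF a p n (θ μ) (L μ) t) μ := by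
  have h1 := F.contG ht hμ
  have h2 := F.cL t ht μ hμ
  unfold FF
  fun_prop

theorem Fam.below {a p n : ℝ} {θ L : ℝ → ℝ → ℝ} (F : Fam a p n θ L) {k : ℕ} {μ T t : ℝ}
    (htT : t ≤ T) (h : -(k : ℝ) * π < θ μ T) : -(k : ℝ) * π < θ μ t := by
  rcases htT.eq_or_lt with rfl | hlt
  · exact h
  · by_contra hc
    push Not at hc
    have := (F.ps μ).barN k hlt hc
    linarith

theorem Fam.memA {a p n : ℝ} {θ L : ℝ → ℝ → ℝ} (F : Fam a p n θ L) {k : ℕ} {μ : ℝ} :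
    μ ∈ SA a p θ L k ↔ 0 < μ ∧ ∃ T, 0 < T ∧ GG a p (θ μ) (L μ) T < 0 ∧
      -(k : ℝ) * π < θ μ T ∧ θ μ T < (1 - (k : ℝ)) * π := by
  constructor
  · rintro ⟨hμ, ⟨⟨t, ht, hlt⟩, hlow⟩, T, hT, hG⟩
    refine ⟨hμ, max t T + 1, by positivity, ?_, hlow _ (by positivity), ?_⟩
    · exact (F.ps μ).G_neg' F.hp hT.le (by linarith [le_max_right t T]) hG
    · exact (F.ps μ).barN' k (by linarith [le_max_left t T]) hlt.le
  · rintro ⟨hμ, T, hT, hG, h1, h2⟩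
    refine ⟨hμ, ⟨⟨T, hT, h2⟩, ?_⟩, T, hT, hG⟩
    intro t ht
    rcases le_total t T with htT | htT
    · exact F.below htT h1
    · by_contra hc
      push Not at hc
      obtain ⟨s, hs, hse⟩ := intermediate_value_Icc' htT
        ((F.ps μ).contθ.continuousOn (s := Icc T t)) 
        (show -(k : ℝ) * π ∈ Icc (θ μ t) (θ μ T) from ⟨hc, h1.le⟩)
      have e1 := (F.ps μ).G_neg' F.hp hT.le hs.1 hG
      have e2 := GG_pos_of (a := a) (p := p) (L := L μ) (-(k : ℤ)) (t := s) (θ := θ μ)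
        (by push_cast; exact hse)
      linarith

theorem Fam.exA {a p n : ℝ} {θ L : ℝ → ℝ → ℝ} (F : Fam a p n θ L) {μ T : ℝ} (hμ : 0 < μ)
    (hT : 0 < T) (hG : GG a p (θ μ) (L μ) T < 0) : ∃ j, μ ∈ SA a p θ L j := by
  have hpi := Real.pi_pos
  have hlt := (F.ps μ).lt_pi (F.h0 μ) hT.le
  have h0 : 0 ≤ 1 - θ μ T / π := by
    rw [sub_nonneg, div_le_one hpi]; exact hlt.le
  have e1 := Nat.floor_le h0
  have e2 := Nat.lt_floor_add_one (1 - θ μ T / π)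
  set j := ⌊1 - θ μ T / π⌋₊ with hj
  have ed : θ μ T = (θ μ T / π) * π := by field_simp
  refine ⟨j, F.memA.2 ⟨hμ, T, hT, hG, ?_, ?_⟩⟩
  · rw [ed]
    exact mul_lt_mul_of_pos_right (by linarith) hpi
  · have : θ μ T ≤ (1 - (j : ℝ)) * π := by
      rw [ed]
      exact mul_le_mul_of_nonneg_right (by linarith) hpi.le
    refine lt_of_le_of_ne this fun e => ?_
    have e2 := GG_pos_of (a := a) (p := p) (L := L μ) (1 - (j : ℤ)) (t := T) (θ := θ μ)
        (by push_cast; exact e)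
    linarith

theorem Fam.exI {a p n : ℝ} {θ L : ℝ → ℝ → ℝ} (F : Fam a p n θ L) {μ B : ℝ} (hμ : 0 < μ)
    (hG : ∀ t, 0 ≤ t → 0 ≤ GG a p (θ μ) (L μ) t) (hB : ∀ t, 0 ≤ t → B ≤ θ μ t) :
    ∃ j : ℕ, μ ∈ SI a p θ L j ∧ B ≤ -(j : ℝ) * π ∧
      (∀ δ, 0 < δ → ∀ᶠ t in atTop, FF a p n (θ μ) (L μ) t < δ) := by
  have hpi := Real.pi_pos
  obtain ⟨z, hz, hlow, hF, _⟩ := (F.ps μ).key F.ha F.hp F.hnp hG hB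
  have hz0 : z ≤ 0 := by
    have := hlow 0 le_rfl
    rw [F.h0] at this
    by_contra hc
    push Not at hc
    have : (1 : ℝ) ≤ z := by exact_mod_cast hc
    nlinarith
  obtain ⟨j, hj⟩ := Int.eq_ofNat_of_zero_le (a := -z) (by omega)
  have hzj : (z : ℝ) = -(j : ℝ) := by
    have : z = -(j : ℤ) := by omega
    rw [this]; push_cast; ring
  rw [hzj] at hz hlow
  refine ⟨j, ⟨hμ, ⟨?_, hlow⟩, hG⟩, ?_, hF⟩
  · obtain ⟨t, h1, h2⟩ := ((hz.eventually (gt_mem_nhds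
      (show -(j : ℝ) * π < (1 - (j : ℝ)) * π by nlinarith))).and (eventually_gt_atTop 0)).exists
    exact ⟨t, h2, h1⟩
  · refine ge_of_tendsto hz ?_
    filter_upwards [eventually_ge_atTop 0] with t ht using hB t ht

theorem Fam.openA {a p n : ℝ} {θ L : ℝ → ℝ → ℝ} (F : Fam a p n θ L) (k : ℕ) :
    IsOpen (SA a p θ L k) := by
  rw [isOpen_iff_eventually]
  intro μ hμ
  obtain ⟨h0, T, hT, h1, h2, h3⟩ := F.memA.1 hμ
  filter_upwards [lt_mem_nhds h0, (F.contG hT.le h0).eventually (gt_mem_nhds h1),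
    (F.cθ T hT.le μ h0).eventually (lt_mem_nhds h2),
    (F.cθ T hT.le μ h0).eventually (gt_mem_nhds h3)] with x g0 g1 g2 g3
  exact F.memA.2 ⟨g0, T, hT, g1, g2, g3⟩

theorem Fam.nearI {a p n : ℝ} {θ L : ℝ → ℝ → ℝ} (F : Fam a p n θ L) {k : ℕ} {μ : ℝ}
    (hμ : μ ∈ SI a p θ L k) :
    ∀ᶠ x in 𝓝 μ, x ∈ SA a p θ L k ∪ SI a p θ L k ∪ SA a p θ L (k + 1) := by
  have hpi := Real.pi_pos
  obtain ⟨h0, hN, hG⟩ := hμ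
  obtain ⟨j, -, -, hF⟩ := F.exI h0 hG (fun t ht => (hN.2 t ht).le)
  obtain ⟨t1, ht1, hlt1⟩ := hN.1
  obtain ⟨T, hFT, hT1, hTt⟩ := ((hF _ (dlt_pos F.ha F.hp)).and
    ((eventually_ge_atTop 1).and (eventually_gt_atTop t1))).exists
  have hT0 : (0 : ℝ) < T := by linarith
  have h2 := hN.2 T hT0.le
  have h3 := (F.ps μ).barN' k hTt hlt1.le
  filter_upwards [lt_mem_nhds h0, (F.contF hT0.le h0).eventually (gt_mem_nhds hFT),
    (F.cθ T hT0.le μ h0).eventually (lt_mem_nhds h2),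
    (F.cθ T hT0.le μ h0).eventually (gt_mem_nhds h3)] with x g0 g1 g2 g3
  have g2' : ((-(k : ℤ) : ℤ) : ℝ) * π ≤ θ x T := by push_cast; exact g2.le
  by_cases hc : ∃ t, 0 < t ∧ GG a p (θ x) (L x) t < 0
  · obtain ⟨t, ht, hGt⟩ := hc
    obtain ⟨j, hj⟩ := F.exA g0 ht hGt
    have j1 : k ≤ j := nat_lt_of_pi (hj.2.1.2 T hT0.le) g3
    have j2 : j ≤ k + 1 := by
      refine hj.2.1.le fun s hs => ?_
      rcases le_total s T with hsT | hsT
      · refine F.below hsT ?_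
        push_cast
        nlinarith
      · have := (F.ps x).lemX' F.ha F.hp F.hnp hT1 (-(k : ℤ)) g2' g1 hsT
        push_cast at this ⊢
        linarith
    have : j = k ∨ j = k + 1 := by omega
    rcases this with rfl | rfl
    · exact Or.inl (Or.inl hj)
    · exact Or.inr hj
  · push Not at hc
    have hG' : ∀ t, 0 ≤ t → 0 ≤ GG a p (θ x) (L x) t := by
      intro t ht
      by_contra hcon
      push Not at hcon
      have e1 := (F.ps x).G_neg' F.hp ht (show t ≤ t + 1 by linarith) hcon
      have e2 := hc (t + 1) (by linarith)
      linarith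
    obtain ⟨j, hj, hjB, -⟩ := F.exI (B := -(k : ℝ) * π - 3 * π / 4) g0 hG' (by
      intro s hs
      rcases le_total s T with hsT | hsT
      · have := F.below hsT g2
        linarith
      · have := (F.ps x).lemX F.ha F.hp F.hnp hT1 hsT (-(k : ℤ)) g2' g1
          (fun t ht => hG' t (hT0.le.trans ht.1))
        push_cast at this
        linarith)
    have j1 : k ≤ j := nat_lt_of_pi (hj.2.1.2 T hT0.le) g3
    have j2 : j ≤ k := nat_lt_of_pi (x := -(j : ℝ) * π + 7 * π / 8) (by linarith) (by linarith)
    have : j = k := le_antisymm j2 j1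
    subst this
    exact Or.inl (Or.inr hj)

theorem Fam.LB_cases {a p n : ℝ} {θ L : ℝ → ℝ → ℝ} (F : Fam a p n θ L) {K : ℕ} {μ : ℝ}
    (hμ : μ ∈ LB θ K) : ∃ j, j ≤ K ∧ (μ ∈ SA a p θ L j ∨ μ ∈ SI a p θ L j) := by
  obtain ⟨h0, hl⟩ := hμ
  by_cases hc : ∃ t, 0 < t ∧ GG a p (θ μ) (L μ) t < 0
  · obtain ⟨t, ht, hGt⟩ := hc
    obtain ⟨j, hj⟩ := F.exA h0 ht hGt
    exact ⟨j, hj.2.1.le hl, Or.inl hj⟩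
  · push Not at hc
    have hG' : ∀ t, 0 ≤ t → 0 ≤ GG a p (θ μ) (L μ) t := by
      intro t ht
      by_contra hcon
      push Not at hcon
      have e1 := (F.ps μ).G_neg' F.hp ht (show t ≤ t + 1 by linarith) hcon
      have e2 := hc (t + 1) (by linarith)
      linarith
    obtain ⟨j, hj, -⟩ := F.exI h0 hG' (fun t ht => (hl t ht).le)
    exact ⟨j, hj.2.1.le hl, Or.inr hj⟩

theorem NN_LB {θ : ℝ → ℝ → ℝ} {k K : ℕ} {μ : ℝ} (h0 : 0 < μ) (h : NN k (θ μ)) (hk : k ≤ K) :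
    μ ∈ LB θ K := by
  refine ⟨h0, fun t ht => lt_of_le_of_lt ?_ (h.2 t ht)⟩
  have : (k : ℝ) ≤ K := by exact_mod_cast hk
  have := Real.pi_pos
  nlinarith

/-- suprema of nonempty bounded subsets of `LB` stay in `LB` -/
theorem Fam.sup_LB {a p n : ℝ} {θ L : ℝ → ℝ → ℝ} (F : Fam a p n θ L) {K : ℕ} {S : Set ℝ}
    (hS : S ⊆ LB θ K) (hne : S.Nonempty) (hb : BddAbove S) : sSup S ∈ LB θ K := by
  have h0 : 0 < sSup S := by
    obtain ⟨x, hx⟩ := hne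
    exact (hS hx).1.trans_le (le_csSup hb hx)
  have hcl := mem_closure_iff_frequently.1 (csSup_mem_closure hne hb)
  have hge : ∀ t, 0 ≤ t → -(K : ℝ) * π ≤ θ (sSup S) t := by
    intro t ht
    by_contra hc
    push Not at hc
    obtain ⟨x, hx1, hx2⟩ := (hcl.and_eventually
      ((F.cθ t ht _ h0).eventually (gt_mem_nhds hc))).exists
    have := (hS hx1).2 t ht
    linarith
  refine ⟨h0, fun t ht => ?_⟩
  refine lt_of_le_of_ne (hge t ht) fun e => ?_
  have := (F.ps (sSup S)).barN K (show t < t + 1 by linarith) e.ge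
  have := hge (t + 1) (by linarith)
  linarith

theorem sup_no_right {S U : Set ℝ} (hb : BddAbove S) (hU : IsOpen U) (hUS : U ⊆ S) :
    sSup S ∉ U := by
  intro hc
  obtain ⟨x, hx1, hx2⟩ := (((hU.eventually_mem hc).filter_mono nhdsWithin_le_nhds).and
    (self_mem_nhdsWithin (s := Ioi (sSup S)))).exists
  have := le_csSup hb (hUS hx1)
  exact absurd hx2 (not_lt.2 this)

theorem Fam.LB_bdd {a p n : ℝ} {θ L : ℝ → ℝ → ℝ} (F : Fam a p n θ L) (K : ℕ) :
    BddAbove (LB θ K) := by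
  obtain ⟨M, hM⟩ := F.large K
  refine ⟨M, fun x hx => ?_⟩
  by_contra hc
  push Not at hc
  have := hM x hc
  have := hx.2 1 zero_le_one
  linarith

theorem Fam.LB_sup {a p n : ℝ} {θ L : ℝ → ℝ → ℝ} (F : Fam a p n θ L) {K : ℕ}
    (hne : (LB θ K).Nonempty) : ∃ x, sSup (LB θ K) < x ∧ x ∈ SA a p θ L (K + 1) := by
  have hb := F.LB_bdd K
  have hs := F.sup_LB subset_rfl hne hb
  obtain ⟨j, hj, hA | hI⟩ := F.LB_cases hs
  · exact absurd hA (sup_no_right hb (F.openA j) fun x hx => NN_LB hx.1 hx.2.1 hj)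
  · obtain ⟨x, hx1, hx2⟩ := (((F.nearI hI).filter_mono nhdsWithin_le_nhds).and
      (self_mem_nhdsWithin (s := Ioi (sSup (LB θ K))))).exists
    have hx2 : sSup (LB θ K) < x := hx2
    have hnot : x ∉ LB θ K := fun hc => absurd (le_csSup hb hc) (not_le.2 hx2)
    refine ⟨x, hx2, ?_⟩
    rcases hx1 with (h1 | h1) | h1
    · exact absurd (NN_LB h1.1 h1.2.1 hj) hnot
    · exact absurd (NN_LB h1.1 h1.2.1 hj) hnot
    · have : j = K := by
        by_contra hne
        exact hnot (NN_LB h1.1 h1.2.1 (by omega))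
      rw [← this]
      exact h1

theorem Fam.three {a p n : ℝ} {θ L : ℝ → ℝ → ℝ} (F : Fam a p n θ L) {k : ℕ}
    (hne : (SA a p θ L k).Nonempty) (hb : BddAbove (SA a p θ L k)) :
    sSup (SA a p θ L k) ∈ SI a p θ L k := by
  have hs := F.sup_LB (K := k) (fun x hx => NN_LB hx.1 hx.2.1 le_rfl) hne hb
  have hcl := mem_closure_iff_frequently.1 (csSup_mem_closure hne hb)
  obtain ⟨j, hj, hA | hI⟩ := F.LB_cases hs
  · obtain ⟨x, hx1, hx2⟩ := (hcl.and_eventually ((F.openA j).eventually_mem hA)).exists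
    have : j = k := hx2.2.1.eq hx1.2.1
    subst this
    exact absurd hA (sup_no_right hb (F.openA j) subset_rfl)
  · rcases hj.eq_or_lt with e | hlt
    · rw [e] at hI; exact hI
    · exfalso
      obtain ⟨K, rfl⟩ : ∃ K, k = K + 1 := ⟨k - 1, by omega⟩
      have hmem : sSup (SA a p θ L (K + 1)) ∈ LB θ K := NN_LB hI.1 hI.2.1 (by omega)
      obtain ⟨x, hx1, hx2⟩ := F.LB_sup ⟨_, hmem⟩
      have e1 := le_csSup (F.LB_bdd K) hmem
      have e2 := le_csSup hb hx2
      linarith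

theorem Fam.four {a p n : ℝ} {θ L : ℝ → ℝ → ℝ} (F : Fam a p n θ L) {k : ℕ}
    (hbA : BddAbove (SA a p θ L k)) (hb : BddAbove (SI a p θ L k))
    (hne : (SI a p θ L k).Nonempty) :
    sSup (SI a p θ L k) ∈ SI a p θ L k ∧
    ∀ᶠ x in 𝓝 (sSup (SI a p θ L k)), sSup (SI a p θ L k) < x → x ∈ SA a p θ L (k + 1) := by
  have hs := F.sup_LB (K := k) (fun x hx => NN_LB hx.1 hx.2.1 le_rfl) hne hb
  have hcl := mem_closure_iff_frequently.1 (csSup_mem_closure hne hb)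
  have hdisj : ∀ x i j, x ∈ SI a p θ L i → x ∉ SA a p θ L j := by
    rintro x i j ⟨_, _, h1⟩ ⟨_, _, t, ht, h2⟩
    have := h1 t ht.le
    linarith
  have hmem : sSup (SI a p θ L k) ∈ SI a p θ L k := by
    obtain ⟨j, hj, hA | hI⟩ := F.LB_cases hs
    · obtain ⟨x, hx1, hx2⟩ := (hcl.and_eventually ((F.openA j).eventually_mem hA)).exists
      exact absurd hx2 (hdisj x _ _ hx1)
    · obtain ⟨x, hx1, (h2 | h2) | h2⟩ := (hcl.and_eventually (F.nearI hI)).exists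
      · exact absurd h2 (hdisj x _ _ hx1)
      · have : j = k := h2.2.1.eq hx1.2.1
        rw [this] at hI
        exact hI
      · exact absurd h2 (hdisj x _ _ hx1)
  refine ⟨hmem, ?_⟩
  filter_upwards [F.nearI hmem] with x hx hlt
  rcases hx with (h | h) | h
  · have e1 := le_csSup hb (F.three ⟨x, h⟩ hbA)
    have e2 := le_csSup hbA h
    linarith
  · have := le_csSup hb h
    linarith
  · exact h

theorem PS.unique' {a p : ℝ} (ha : 1 / 2 ≤ a) (hp : 0 < p) {θ L θ' L' : ℝ → ℝ}
    (h : PS a p θ L) (h' : PS a p θ' L') (e1 : θ 0 = π / 4) (e1' : θ' 0 = π / 4)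
    (e2 : L 0 = L' 0) : θ = θ' ∧ L = L' := by
  have key : ∀ t, θ t = θ' t ∧ L t = L' t := by
    intro t
    rcases le_total 0 t with ht | ht
    · exact h.unique ha hp h' (e1.trans e1'.symm) e2 ht
    · have hu := h.unique ha hp h' (e1.trans e1'.symm) e2 (t := -t) (by linarith)
      have s1 := h.symm ha hp e1 t
      have s2 := h'.symm ha hp e1' t
      constructor
      · linarith [s1.1, s2.1, hu.1]
      · linarith [s1.2, s2.2, hu.2]
  exact ⟨funext fun t => (key t).1, funext fun t => (key t).2⟩

theorem init_eq {m : ℕ} (hm : 3 ≤ m) {μ : ℝ} (hμ : 0 < μ) {L : ℝ → ℝ}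
    (hL : L 0 = (1 / ((m : ℝ) - 1)) * log (μ ^ 2 + μ ^ 2)) :
    rr ((m : ℝ) - 1) L 0 * (√2 / 2) = μ := by
  have hm' : (3 : ℝ) ≤ m := by exact_mod_cast hm
  have h1 : (m : ℝ) - 1 ≠ 0 := by linarith
  have hr := rr_pos ((m : ℝ) - 1) L 0
  have h2 : rr ((m : ℝ) - 1) L 0 ^ 2 = μ ^ 2 + μ ^ 2 := by
    rw [rr_sq, Real.cosh_zero, one_mul, hL, show ((m : ℝ) - 1) * ((1 / ((m : ℝ) - 1)) *
      log (μ ^ 2 + μ ^ 2)) = log (μ ^ 2 + μ ^ 2) by field_simp, Real.exp_log (by positivity)]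
  have h3 : (rr ((m : ℝ) - 1) L 0 * (√2 / 2)) ^ 2 = μ ^ 2 := by
    have := Real.sq_sqrt (show (0 : ℝ) ≤ 2 by norm_num)
    rw [mul_pow, h2, div_pow, this]; ring
  have h4 : 0 ≤ rr ((m : ℝ) - 1) L 0 * (√2 / 2) := by positivity
  exact (pow_left_inj₀ h4 hμ.le two_ne_zero).1 h3

theorem setA_iff {m : ℕ} (hm : 3 ≤ m) {μ : ℝ} (hμ : 0 < μ) {θ L : ℝ → ℝ}
    (h : PS (((m : ℝ) - 2) / 2) (1 / ((m : ℝ) - 1)) θ L) (h0 : θ 0 = π / 4)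
    (hL : L 0 = (1 / ((m : ℝ) - 1)) * log (μ ^ 2 + μ ^ 2)) (k : ℕ) :
    μ ∈ setA m k ↔ NN k θ ∧
      ∃ t, 0 < t ∧ GG (((m : ℝ) - 2) / 2) (1 / ((m : ℝ) - 1)) θ L t < 0 := by
  have hm' : (3 : ℝ) ≤ m := by exact_mod_cast hm
  have ha : 1 / 2 ≤ ((m : ℝ) - 2) / 2 := by linarith
  have hp : 0 < 1 / ((m : ℝ) - 1) := by apply one_div_pos.2; linarith
  constructor
  · rintro ⟨_, u, v, hs, hu, hv, hE, hN⟩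
    obtain ⟨θ', L', h', h0', hL', huv⟩ := toPolar hm hμ hs hu hv
    obtain ⟨rfl, rfl⟩ := h.unique' ha hp h' h0 h0' (hL.trans hL'.symm)
    exact ⟨(exactly_iff h h0 (fun t => (huv t).2) k).1 hE, (energy_iff hm h h0 huv).1 hN⟩
  · rintro ⟨hE, hN⟩
    have hi := init_eq hm hμ hL
    refine ⟨hμ, _, _, toUV hm h, ?_, ?_, ?_, ?_⟩
    · simp only [h0, Real.cos_pi_div_four]; exact hi
    · simp only [h0, Real.sin_pi_div_four]; exact hi
    · exact (exactly_iff h h0 (fun t => rfl) k).2 hE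
    · exact (energy_iff hm h h0 (fun t => ⟨rfl, rfl⟩)).2 hN

theorem setI_iff {m : ℕ} (hm : 3 ≤ m) {μ : ℝ} (hμ : 0 < μ) {θ L : ℝ → ℝ}
    (h : PS (((m : ℝ) - 2) / 2) (1 / ((m : ℝ) - 1)) θ L) (h0 : θ 0 = π / 4)
    (hL : L 0 = (1 / ((m : ℝ) - 1)) * log (μ ^ 2 + μ ^ 2)) (k : ℕ) :
    μ ∈ setI m k ↔ NN k θ ∧
      ∀ t, 0 ≤ t → 0 ≤ GG (((m : ℝ) - 2) / 2) (1 / ((m : ℝ) - 1)) θ L t := by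
  have hm' : (3 : ℝ) ≤ m := by exact_mod_cast hm
  have ha : 1 / 2 ≤ ((m : ℝ) - 2) / 2 := by linarith
  have hp : 0 < 1 / ((m : ℝ) - 1) := by apply one_div_pos.2; linarith
  have hnp : ((m : ℝ) - 1) * (1 / ((m : ℝ) - 1)) = 1 := by
    have h1 : (m : ℝ) - 1 ≠ 0 := by linarith
    field_simp
  have hc : 0 < ((m : ℝ) - 1) / (2 * m) := by apply div_pos <;> linarith
  constructor
  · rintro ⟨_, u, v, hs, hu, hv, hE, hN, _⟩
    obtain ⟨θ', L', h', h0', hL', huv⟩ := toPolar hm hμ hs hu hv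
    obtain ⟨rfl, rfl⟩ := h.unique' ha hp h' h0 h0' (hL.trans hL'.symm)
    refine ⟨(exactly_iff h h0 (fun t => (huv t).2) k).1 hE, fun t ht => ?_⟩
    have := hN t
    rw [H2_eq hm (huv t).1 (huv t).2] at this
    exact (FF_pos_iff.1 ((mul_pos_iff_of_pos_left hc).1 this)).le
  · rintro ⟨hE, hN⟩
    have hi := init_eq hm hμ hL
    refine ⟨hμ, _, _, toUV hm h, ?_, ?_, ?_, ?_, ?_⟩
    · simp only [h0, Real.cos_pi_div_four]; exact hi
    · simp only [h0, Real.sin_pi_div_four]; exact hi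
    · exact (exactly_iff h h0 (fun t => rfl) k).2 hE
    · intro t
      rw [H2_eq (u := fun t => rr ((m : ℝ) - 1) L t * cos (θ t))
        (v := fun t => rr ((m : ℝ) - 1) L t * sin (θ t)) hm rfl rfl]
      refine mul_pos hc ?_
      have key : ∀ s, 0 ≤ s →
          0 < cosh s * FF (((m : ℝ) - 2) / 2) (1 / ((m : ℝ) - 1)) ((m : ℝ) - 1) θ L s := by
        intro s hs
        rw [FF_pos_iff]
        by_contra hcon
        push Not at hcon
        have e1 := h.G_neg hp hs (show s < s + 1 by linarith) hcon
        have e2 := hN (s + 1) (by linarith)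
        linarith
      rcases le_total 0 t with ht | ht
      · exact key t ht
      · rw [← HH_even _ ha hp h h0]
        exact key (-t) (by linarith)
    · obtain ⟨j, _, _, _, M, hM⟩ := h.key ha hp hnp hN (fun t ht => (hE.2 t ht).le)
      have hr : ∀ t, rr ((m : ℝ) - 1) L t ≤ M + 1 := by
        intro t
        have h2 : rr ((m : ℝ) - 1) L t ^ 2 ≤ M := by
          rw [rr_sq]
          rcases le_total 0 t with ht | ht
          · exact hM t ht
          · have := hM (-t) (by linarith)
            rwa [Real.cosh_neg, (h.symm ha hp h0 t).2] at this
        nlinarith [sq_nonneg (rr ((m : ℝ) - 1) L t - 1)]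
      refine ⟨2 * (M + 1), fun t => ?_⟩
      have hp := rr_pos ((m : ℝ) - 1) L t
      have e := hr t
      rw [abs_mul, abs_mul, abs_of_pos hp]
      have e1 := Real.abs_cos_le_one (θ t)
      have e2 := Real.abs_sin_le_one (θ t)
      nlinarith

theorem exists_Fam {m : ℕ} (hm : 3 ≤ m) : ∃ θ L : ℝ → ℝ → ℝ,
    Fam (((m : ℝ) - 2) / 2) (1 / ((m : ℝ) - 1)) ((m : ℝ) - 1) θ L ∧
    (∀ k, setA m k = SA (((m : ℝ) - 2) / 2) (1 / ((m : ℝ) - 1)) θ L k) ∧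
    (∀ k, setI m k = SI (((m : ℝ) - 2) / 2) (1 / ((m : ℝ) - 1)) θ L k) := by
  have hm' : (3 : ℝ) ≤ m := by exact_mod_cast hm
  have ha : 1 / 2 ≤ ((m : ℝ) - 2) / 2 := by linarith
  have hp : 0 < 1 / ((m : ℝ) - 1) := by apply one_div_pos.2; linarith
  have hnp : ((m : ℝ) - 1) * (1 / ((m : ℝ) - 1)) = 1 := by
    have h1 : (m : ℝ) - 1 ≠ 0 := by linarith
    field_simp
  obtain ⟨Θ, Λ, h, hcont⟩ := exists_flow ha hp
  set ℓ : ℝ → ℝ := fun μ => (1 / ((m : ℝ) - 1)) * log (μ ^ 2 + μ ^ 2) with hℓ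
  have hℓc : ∀ μ, 0 < μ → ContinuousAt ℓ μ := by
    intro μ hμ
    have : μ ^ 2 + μ ^ 2 ≠ 0 := by positivity
    simp only [hℓ]
    fun_prop (disch := assumption)
  have hℓt : Tendsto ℓ atTop atTop := by
    refine Tendsto.const_mul_atTop hp (Real.tendsto_log_atTop.comp ?_)
    refine tendsto_atTop_mono' _ ?_ tendsto_id
    filter_upwards [eventually_ge_atTop 1] with x hx
    simp only [id]
    nlinarith
  refine ⟨fun μ => Θ (ℓ μ), fun μ => Λ (ℓ μ), ⟨ha, hp, hnp, fun μ => (h _).1, fun μ => (h _).2.1,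
    ?_, ?_, ?_⟩, ?_, ?_⟩
  · intro t ht μ hμ
    exact ContinuousAt.comp (g := fun l => Θ l t) (hcont t ht).1.continuousAt (hℓc μ hμ)
  · intro t ht μ hμ
    exact ContinuousAt.comp (g := fun l => Λ l t) (hcont t ht).2.continuousAt (hℓc μ hμ)
  · intro K
    have h1 : Tendsto (fun μ => exp (ℓ μ - (2 * (((m : ℝ) - 2) / 2) * (1 / ((m : ℝ) - 1))
        + 1 / ((m : ℝ) - 1)))) atTop atTop :=
      Real.tendsto_exp_atTop.comp (tendsto_atTop_add_const_right _ _ hℓt)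
    obtain ⟨M, hM⟩ := eventually_atTop.1
      (h1.eventually (eventually_gt_atTop (π / 4 + ((m : ℝ) - 2) / 2 + K * π)))
    refine ⟨M, fun μ hμ => ?_⟩
    have e1 := hM μ hμ.le
    have e2 := (h (ℓ μ)).1.large ha hp
    rw [(h (ℓ μ)).2.1, (h (ℓ μ)).2.2] at e2
    linarith
  · intro k
    ext μ
    constructor
    · intro hμ
      exact ⟨hμ.1, (setA_iff hm hμ.1 (h _).1 (h _).2.1 (h _).2.2 k).1 hμ⟩
    · rintro ⟨h0, hr⟩
      exact (setA_iff hm h0 (h _).1 (h _).2.1 (h _).2.2 k).2 hr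
  · intro k
    ext μ
    constructor
    · intro hμ
      exact ⟨hμ.1, (setI_iff hm hμ.1 (h _).1 (h _).2.1 (h _).2.2 k).1 hμ⟩
    · rintro ⟨h0, hr⟩
      exact (setI_iff hm h0 (h _).1 (h _).2.1 (h _).2.2 k).2 hr


theorem stmt18 (m : ℕ) (hm : 3 ≤ m) (k : ℕ) :
    IsOpen (setA m k) ∧ setA m k ⊆ Set.Ioi 0 ∧
    (∀ μ ∈ setI m k, ∃ ε : ℝ, 0 < ε ∧
      Set.Ioo (μ - ε) (μ + ε) ⊆ setA m k ∪ setI m k ∪ setA m (k + 1)) ∧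
    ((setA m k).Nonempty → BddAbove (setA m k) → sSup (setA m k) ∈ setI m k) ∧
    (BddAbove (setA m k) → BddAbove (setI m k) → (setI m k).Nonempty →
      sSup (setI m k) ∈ setI m k ∧
      ∃ ε : ℝ, 0 < ε ∧
        Set.Ioo (sSup (setI m k)) (sSup (setI m k) + ε) ⊆ setA m (k + 1)) := by
  obtain ⟨θ, L, F, hA, hI⟩ := exists_Fam hm
  simp only [hA, hI]
  refine ⟨F.openA k, fun x hx => hx.1, ?_, fun h1 h2 => F.three h1 h2, ?_⟩
  · intro μ hμ
    obtain ⟨ε, hε, hsub⟩ := Metric.eventually_nhds_iff_ball.1 (F.nearI hμ)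
    refine ⟨ε, hε, fun x hx => hsub x ?_⟩
    rw [Real.ball_eq_Ioo]
    exact hx
  · intro h1 h2 h3
    obtain ⟨g1, g2⟩ := F.four h1 h2 h3
    refine ⟨g1, ?_⟩
    obtain ⟨ε, hε, hsub⟩ := Metric.eventually_nhds_iff_ball.1 g2
    refine ⟨ε, hε, fun x hx => hsub x ?_ hx.1⟩
    rw [Real.ball_eq_Ioo]
    exact ⟨by linarith [hx.1], hx.2⟩
end
end
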